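/- Let t be a positive integer and r_1,...,r_t positive real numbers. Then the set R_2(r_1,...,r_t) has positive lower asymptotic density if and only if 1/r_1 + ... + 1/r_t ≥ 1. -/

import Mathlib

open Filter

lemma exists_polynomial_approx_rpow (m : ℕ) : ∀ r : ℝ, (m : ℝ) ≤ r → r ≤ m + 1 →
    ∃ β > (0 : ℝ), ∃ C ≥ (0 : ℝ), ∀ l : ℝ, 1 ≤ l → ∃ c : ℕ → ℝ, c m = β * l ^ (r - m) ∧
      ∀ h : ℝ, 0 ≤ h →
        |(l + h) ^ r - ∑ j ∈ Finset.range (m + 1), c j * h ^ j| ≤ C * h ^ (m + 1) := by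
  induction m with
  | zero =>
    intro r hr0 hr1
    norm_num at hr0 hr1
    refine ⟨1, one_pos, 1, zero_le_one, fun l hl => ⟨fun _ => l ^ r, by simp, fun h hh => ?_⟩⟩
    simp only [zero_add, Finset.range_one, Finset.sum_singleton, pow_zero, mul_one, pow_one,
      one_mul]
    rw [abs_of_nonneg (sub_nonneg.2 (Real.rpow_le_rpow (by linarith) (by linarith) hr0))]
    have h1 : (l + h) ^ r = l ^ r * (1 + h / l) ^ r := by
      rw [← Real.mul_rpow (by linarith) (by positivity)]
      congr 1
      field_simp
    have h2 : (1 + h / l) ^ r ≤ 1 + h / l := by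
      calc (1 + h / l) ^ r ≤ (1 + h / l) ^ (1 : ℝ) :=
            Real.rpow_le_rpow_of_exponent_le (by have : 0 ≤ h / l := by positivity
                                                 linarith) hr1
        _ = _ := Real.rpow_one _
    have h3 : l ^ r ≤ l := by
      calc l ^ r ≤ l ^ (1 : ℝ) := Real.rpow_le_rpow_of_exponent_le hl hr1
        _ = _ := Real.rpow_one _
    have h4 : 0 < l ^ r := by positivity
    calc (l + h) ^ r - l ^ r ≤ l ^ r * (1 + h / l) - l ^ r := by rw [h1]; gcongr
      _ = l ^ r * (h / l) := by ring
      _ ≤ l * (h / l) := by gcongr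
      _ = h := by field_simp
  | succ m ih =>
    intro r hr0 hr1
    push_cast at hr0 hr1
    obtain ⟨β, hβ, C, hC, H⟩ := ih (r - 1) (by linarith) (by linarith)
    have hr : 0 < r := by have : (0 : ℝ) ≤ m := by positivity
                          linarith
    refine ⟨r * β / (m + 1), by positivity, r * C, by positivity, fun l hl => ?_⟩
    obtain ⟨c, hc, hc'⟩ := H l hl
    refine ⟨fun j => if j = 0 then l ^ r else r * c (j - 1) / j, ?_, fun h hh => ?_⟩
    · simp only [Nat.add_eq_zero_iff, one_ne_zero, and_false, if_false, Nat.add_sub_cancel, hc]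
      push_cast
      rw [show r - 1 - (m : ℝ) = r - (m + 1) by ring]
      ring
    have hsum : ∀ x : ℝ, (∑ j ∈ Finset.range (m + 1 + 1),
        (if j = 0 then l ^ r else r * c (j - 1) / j) * x ^ j)
        = (∑ j ∈ Finset.range (m + 1), r * c j / (j + 1) * x ^ (j + 1)) + l ^ r := by
      intro x
      rw [Finset.sum_range_succ']
      simp
    rw [hsum]
    set F : ℝ → ℝ := fun x => (l + x) ^ r -
      ((∑ j ∈ Finset.range (m + 1), r * c j / (j + 1) * x ^ (j + 1)) + l ^ r) with hF
    have hder : ∀ x ∈ Set.Icc (0 : ℝ) h, HasDerivWithinAt F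
        (r * ((l + x) ^ (r - 1) - ∑ j ∈ Finset.range (m + 1), c j * x ^ j)) (Set.Icc 0 h) x := by
      intro x hx
      apply HasDerivAt.hasDerivWithinAt
      have h1 : HasDerivAt (fun x : ℝ => (l + x) ^ r) (1 * r * (l + x) ^ (r - 1)) x :=
        ((hasDerivAt_id x).const_add l).rpow_const (Or.inl (by simp; linarith [hx.1]))
      have h2 : HasDerivAt (fun x : ℝ => ∑ j ∈ Finset.range (m + 1),
          r * c j / (j + 1) * x ^ (j + 1))
          (∑ j ∈ Finset.range (m + 1), r * c j / (j + 1) * ((j + 1 : ℕ) * x ^ j)) x := by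
        apply HasDerivAt.fun_sum
        intro j _
        exact (hasDerivAt_pow (j + 1) x).const_mul _
      refine (h1.sub (h2.add_const (l ^ r))).congr_deriv ?_
      rw [mul_sub, Finset.mul_sum]
      congr 1
      · ring
      · refine Finset.sum_congr rfl fun j _ => ?_
        push_cast
        field_simp
    have := Convex.norm_image_sub_le_of_norm_hasDerivWithin_le (C := r * C * h ^ (m + 1)) hder
      (fun x hx => by
        rw [norm_mul, Real.norm_of_nonneg hr.le, mul_assoc, Real.norm_eq_abs]
        refine mul_le_mul_of_nonneg_left ((hc' x hx.1).trans ?_) hr.le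
        gcongr
        · exact hx.1
        · exact hx.2) (convex_Icc 0 h) (Set.left_mem_Icc.2 hh) (Set.right_mem_Icc.2 hh)
    have hF0 : F 0 = 0 := by simp [hF]
    rw [hF0, sub_zero, sub_zero, Real.norm_eq_abs, Real.norm_of_nonneg hh] at this
    calc _ ≤ _ := this
      _ = _ := by ring

/-- Integer product of all differences of distinct nodes. -/
def nodeDisc (s : Finset ℕ) : ℤ := ∏ i ∈ s, ∏ j ∈ s.erase i, ((i : ℤ) - j)

/-- `nodeDisc s` times the divided-difference weight of the node `i`. -/
def nodeWt (s : Finset ℕ) (i : ℕ) : ℤ := ∏ i' ∈ s.erase i, ∏ j ∈ s.erase i', ((i' : ℤ) - j)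

lemma nodeDisc_ne_zero (s : Finset ℕ) : nodeDisc s ≠ 0 := by
  refine Finset.prod_ne_zero_iff.2 fun i _ => Finset.prod_ne_zero_iff.2 fun j hj => ?_
  have := (Finset.mem_erase.1 hj).1
  omega

lemma sum_nodeWt_mul (s : Finset ℕ) (m : ℕ) (hs : s.card = m + 1) (l : ℝ) (c : ℕ → ℝ) :
    ∑ i ∈ s, (nodeWt s i : ℝ) * ∑ j ∈ Finset.range (m + 1), c j * ((i : ℝ) - l) ^ j
      = nodeDisc s * c m := by
  classical
  set P : Polynomial ℝ := ∑ j ∈ Finset.range (m + 1), Polynomial.C (c j) * Polynomial.X ^ j with hP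
  have hdeg : P.natDegree ≤ m := by
    refine Polynomial.natDegree_sum_le_of_forall_le _ _ fun j hj => ?_
    exact (Polynomial.natDegree_C_mul_X_pow_le _ _).trans (by simp at hj; omega)
  have hcoeff : P.coeff m = c m := by
    simp [hP, Polynomial.coeff_X_pow]
  have hev : ∀ x : ℝ, P.eval x = ∑ j ∈ Finset.range (m + 1), c j * x ^ j := by
    intro x; simp [hP, Polynomial.eval_finsetSum]
  have key := Lagrange.coeff_eq_sum (s := s) (v := fun i : ℕ => (i : ℝ) - l)
    (fun a _ b _ h => by simpa using h) (P := P) (by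
      rw [hs]; exact (Polynomial.degree_le_of_natDegree_le hdeg).trans_lt (by norm_cast; omega))
  rw [hs, Nat.add_sub_cancel, hcoeff] at key
  rw [key, Finset.mul_sum]
  refine Finset.sum_congr rfl fun i hi => ?_
  rw [hev]
  have h1 : (nodeDisc s : ℝ) = nodeWt s i * ∏ j ∈ s.erase i, ((i : ℝ) - j) := by
    rw [nodeDisc, nodeWt, ← Finset.prod_erase_mul _ _ hi]
    push_cast
    rfl
  have h2 : ∏ j ∈ s.erase i, ((i : ℝ) - l - (j - l)) = ∏ j ∈ s.erase i, ((i : ℝ) - j) :=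
    Finset.prod_congr rfl fun j _ => by ring
  have h3 : ∏ j ∈ s.erase i, ((i : ℝ) - j) ≠ 0 := by
    refine Finset.prod_ne_zero_iff.2 fun j hj => ?_
    have := (Finset.mem_erase.1 hj).1
    exact sub_ne_zero.2 (by exact_mod_cast this.symm)
  rw [h2, h1]
  field_simp

lemma abs_prod_node_le (s u : Finset ℕ) (hu : u ⊆ s) (m H l : ℕ) (hs : s.card = m + 1)
    (hH : 1 ≤ H) (hl : ∀ i ∈ s, l ≤ i ∧ i < l + H) :
    |∏ i ∈ u, ∏ j ∈ s.erase i, ((i : ℤ) - j)| ≤ (H : ℤ) ^ (m * (m + 1)) := by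
  have h1 : ∀ i ∈ u, |∏ j ∈ s.erase i, ((i : ℤ) - j)| ≤ (H : ℤ) ^ m := by
    intro i hi
    rw [Finset.abs_prod]
    calc ∏ j ∈ s.erase i, |(i : ℤ) - j| ≤ ∏ j ∈ s.erase i, (H : ℤ) := by
          refine Finset.prod_le_prod (fun _ _ => abs_nonneg _) fun j hj => ?_
          have a := hl i (hu hi)
          have b := hl j (Finset.mem_of_mem_erase hj)
          rw [abs_le]; omega
      _ = _ := by rw [Finset.prod_const, Finset.card_erase_of_mem (hu hi), hs]; simp
  rw [Finset.abs_prod]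
  calc _ ≤ ∏ i ∈ u, (H : ℤ) ^ m := Finset.prod_le_prod (fun _ _ => abs_nonneg _) h1
    _ = (H : ℤ) ^ (m * u.card) := by rw [Finset.prod_const, ← pow_mul]
    _ ≤ _ := by
      have := Finset.card_le_card hu
      gcongr
      · exact_mod_cast hH
      · omega

lemma sum_nodeWt (s : Finset ℕ) (m : ℕ) (hm : 1 ≤ m) (hs : s.card = m + 1) :
    ∑ i ∈ s, nodeWt s i = 0 := by
  have := sum_nodeWt_mul s m hs 0 (fun j => if j = 0 then 1 else 0)
  simp only [ite_mul, one_mul, zero_mul, Finset.sum_ite_eq', Finset.mem_range, Nat.succ_pos,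
    if_true, pow_zero, mul_one] at this
  rw [if_neg (by omega)] at this
  simp at this
  exact_mod_cast this

/-- A set of `m + 1` close integers with `⌊i ^ r⌋₊` all in one residue class mod `e` forces the
leading Taylor coefficient to be near a multiple of `e`. -/
lemma exists_near_multiple (m : ℕ) (hm : 1 ≤ m) (r : ℝ) (hr : (m : ℝ) ≤ r) (hr' : r ≤ m + 1) :
    ∃ β > (0 : ℝ), ∃ C > (0 : ℝ), ∀ (e c H l : ℕ) (s : Finset ℕ), 1 ≤ H → 1 ≤ l →
      s.card = m + 1 → (∀ i ∈ s, l ≤ i ∧ i < l + H) → (∀ i ∈ s, ⌊(i : ℝ) ^ r⌋₊ ≡ c [MOD e]) →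
      ∃ D : ℕ, 1 ≤ D ∧ D ≤ H ^ (m * (m + 1)) ∧ ∃ j : ℤ,
        |D * (β * (l : ℝ) ^ (r - m)) - e * j| ≤ C * H ^ ((m + 1) * (m + 1)) := by
  obtain ⟨β, hβ, C, hC, hT⟩ := exists_polynomial_approx_rpow m r hr hr'
  refine ⟨β, hβ, (m + 1) * (C + 1), by positivity, ?_⟩
  intro e c H l s hH hl hs hsl hmod
  obtain ⟨a, ha, ha'⟩ := hT l (by exact_mod_cast hl)
  have hD : |nodeDisc s| ≤ (H : ℤ) ^ (m * (m + 1)) :=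
    abs_prod_node_le s s subset_rfl m H l hs hH hsl
  have hw : ∀ i, |nodeWt s i| ≤ (H : ℤ) ^ (m * (m + 1)) := fun i =>
    abs_prod_node_le s _ (Finset.erase_subset _ _) m H l hs hH hsl
  have hq : ∀ i ∈ s, ∃ q : ℤ, (⌊(i : ℝ) ^ r⌋₊ : ℤ) = c + e * q := by
    intro i hi
    obtain ⟨q, hq⟩ := (Nat.modEq_iff_dvd.1 (hmod i hi).symm)
    exact ⟨q, by linarith⟩
  choose! q hq using hq
  have hJ : ∑ i ∈ s, nodeWt s i * (⌊(i : ℝ) ^ r⌋₊ : ℤ) = e * ∑ i ∈ s, nodeWt s i * q i := by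
    have : ∑ i ∈ s, nodeWt s i * (⌊(i : ℝ) ^ r⌋₊ : ℤ) =
        c * ∑ i ∈ s, nodeWt s i + e * ∑ i ∈ s, nodeWt s i * q i := by
      rw [Finset.mul_sum, Finset.mul_sum, ← Finset.sum_add_distrib]
      refine Finset.sum_congr rfl fun i hi => ?_
      rw [hq i hi]; ring
    rw [this, sum_nodeWt s m hm hs]; ring
  have hmain :
      |(nodeDisc s : ℝ) * (β * (l : ℝ) ^ (r - m)) - e * ((∑ i ∈ s, nodeWt s i * q i : ℤ) : ℝ)|
      ≤ (m + 1) * (C + 1) * H ^ ((m + 1) * (m + 1)) := by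
    have h1 : (e : ℝ) * ((∑ i ∈ s, nodeWt s i * q i : ℤ) : ℝ)
        = ∑ i ∈ s, (nodeWt s i : ℝ) * (⌊(i : ℝ) ^ r⌋₊ : ℝ) := by
      exact_mod_cast hJ.symm
    rw [h1, ← ha, ← sum_nodeWt_mul s m hs l a, ← Finset.sum_sub_distrib]
    refine (Finset.abs_sum_le_sum_abs _ _).trans ?_
    have h2 : ∀ i ∈ s, |(nodeWt s i : ℝ) * ∑ j ∈ Finset.range (m + 1), a j * ((i : ℝ) - l) ^ j
        - (nodeWt s i : ℝ) * (⌊(i : ℝ) ^ r⌋₊ : ℝ)| ≤ (C + 1) * H ^ ((m + 1) * (m + 1)) := by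
      intro i hi
      have hi1 : (l : ℝ) ≤ i := by exact_mod_cast (hsl i hi).1
      have hi2 : (i : ℝ) - l ≤ H := by
        have : (i : ℝ) < l + H := by exact_mod_cast (hsl i hi).2
        linarith
      have h3 := ha' ((i : ℝ) - l) (by linarith)
      rw [show (l : ℝ) + (i - l) = i by ring] at h3
      have h4 : C * ((i : ℝ) - l) ^ (m + 1) ≤ C * H ^ (m + 1) := by
        gcongr
      have h5 : |(∑ j ∈ Finset.range (m + 1), a j * ((i : ℝ) - l) ^ j) - (⌊(i : ℝ) ^ r⌋₊ : ℝ)|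
          ≤ C * H ^ (m + 1) + 1 := by
        have h6 := Nat.floor_le (show (0 : ℝ) ≤ (i : ℝ) ^ r by positivity)
        have h7 := Nat.lt_floor_add_one ((i : ℝ) ^ r)
        rw [abs_le] at h3 ⊢
        constructor <;> linarith [h3.1, h3.2]
      have h8 : (1 : ℝ) ≤ (H : ℝ) ^ (m + 1) := one_le_pow₀ (by exact_mod_cast hH)
      have h9 : |(nodeWt s i : ℝ)| ≤ (H : ℝ) ^ (m * (m + 1)) := by exact_mod_cast hw i
      rw [← mul_sub, abs_mul]
      calc _ ≤ (H : ℝ) ^ (m * (m + 1)) * (C * H ^ (m + 1) + 1) := by gcongr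
        _ ≤ (H : ℝ) ^ (m * (m + 1)) * (C * H ^ (m + 1) + H ^ (m + 1)) := by gcongr
        _ = _ := by rw [add_mul m 1 (m + 1), pow_add]; ring
    calc _ ≤ ∑ i ∈ s, (C + 1) * (H : ℝ) ^ ((m + 1) * (m + 1)) := Finset.sum_le_sum h2
      _ = _ := by rw [Finset.sum_const, hs, nsmul_eq_mul]; push_cast; ring
  refine ⟨(nodeDisc s).natAbs, Int.natAbs_pos.2 (nodeDisc_ne_zero s), by zify; exact hD, ?_⟩
  rcases Int.natAbs_eq (nodeDisc s) with h | h
  · refine ⟨∑ i ∈ s, nodeWt s i * q i, ?_⟩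
    have : ((nodeDisc s).natAbs : ℝ) = nodeDisc s := by
      rw [← Int.cast_natCast, ← h]
    rw [this]; exact hmain
  · refine ⟨-∑ i ∈ s, nodeWt s i * q i, ?_⟩
    have : ((nodeDisc s).natAbs : ℝ) = -nodeDisc s := by
      have : ((nodeDisc s).natAbs : ℤ) = -nodeDisc s := by omega
      rw [← Int.cast_natCast, this, Int.cast_neg]
    rw [this, ← abs_neg]
    convert hmain using 2
    push_cast; ring

lemma nodeDisc_dvd (m : ℕ) (hm : 1 ≤ m) (e c : ℕ) (s : Finset ℕ) 
    (hs : s.card = m + 1) (hmod : ∀ i ∈ s, i ^ m ≡ c [MOD e]) : (e : ℤ) ∣ nodeDisc s := by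
  have hq : ∀ i ∈ s, ∃ q : ℤ, ((i : ℤ) ^ m) = c + e * q := by
    intro i hi
    obtain ⟨q, hq⟩ := (Nat.modEq_iff_dvd.1 (hmod i hi).symm)
    exact ⟨q, by push_cast at hq; linarith⟩
  choose! q hq using hq
  refine ⟨∑ i ∈ s, nodeWt s i * q i, ?_⟩
  have h1 := sum_nodeWt_mul s m hs 0 (fun j => if j = m then 1 else 0)
  simp only [ite_mul, one_mul, zero_mul, Finset.sum_ite_eq', Finset.mem_range, Nat.lt_succ_self,
    if_true, sub_zero, mul_one] at h1
  have h2 : ∑ i ∈ s, nodeWt s i * (i : ℤ) ^ m = nodeDisc s := by exact_mod_cast h1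
  rw [← h2]
  have : ∑ i ∈ s, nodeWt s i * (i : ℤ) ^ m =
      c * ∑ i ∈ s, nodeWt s i + e * ∑ i ∈ s, nodeWt s i * q i := by
    rw [Finset.mul_sum, Finset.mul_sum, ← Finset.sum_add_distrib]
    refine Finset.sum_congr rfl fun i hi => ?_
    rw [hq i hi]; ring
  rw [this, sum_nodeWt s m hm hs]; ring

lemma card_sparse_le (S : Finset ℕ) (K H m : ℕ) (hH : 1 ≤ H) (hS : S ⊆ Finset.Icc 1 K)
    (hsp : ∀ s ∈ S, ∃ T : Finset ℕ, S ⊆ T ∧ (T.filter (fun i => s ≤ i ∧ i < s + H)).card ≤ m) :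
    S.card ≤ m * (K / H + 1) := by
  have h1 : S.card ≤ m * (S.image (· / H)).card := by
    refine Finset.card_le_mul_card_image S m fun b _ => ?_
    rcases (S.filter (fun x => x / H = b)).eq_empty_or_nonempty with h0 | h0
    · rw [h0]; simp
    set F := S.filter (fun x => x / H = b) with hF
    have hmin := Finset.min'_mem F h0
    obtain ⟨T, hST, hT⟩ := hsp _ (Finset.mem_filter.1 hmin).1
    refine le_trans (Finset.card_le_card fun x hx => ?_) hT
    have hx' := Finset.mem_filter.1 hx
    refine Finset.mem_filter.2 ⟨hST hx'.1, Finset.min'_le F x hx, ?_⟩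
    have hb := (Finset.mem_filter.1 hmin).2
    have h2 := hx'.2
    have h3 := Nat.div_add_mod x H
    have h4 := Nat.div_add_mod (F.min' h0) H
    have h5 := Nat.mod_lt x hH
    rw [h2] at h3
    rw [hb] at h4
    omega
  refine h1.trans (Nat.mul_le_mul_left _ ?_)
  calc _ ≤ (Finset.range (K / H + 1)).card := by
        refine Finset.card_le_card fun x hx => ?_
        obtain ⟨y, hy, rfl⟩ := Finset.mem_image.1 hx
        have := (Finset.mem_Icc.1 (hS hy)).2
        exact Finset.mem_range.2 (Nat.lt_succ_of_le (Nat.div_le_div_right this))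
    _ = _ := Finset.card_range _

lemma card_le_of_diam (S : Finset ℕ) (R : ℝ) (hR : 0 ≤ R)
    (h : ∀ a ∈ S, ∀ b ∈ S, a ≤ b → (b : ℝ) - a ≤ R) : (S.card : ℝ) ≤ R + 1 := by
  rcases S.eq_empty_or_nonempty with h0 | h0
  · rw [h0]; simp; linarith
  have h1 := h _ (S.min'_mem h0) _ (S.max'_mem h0) (S.min'_le _ (S.max'_mem h0))
  have h2 : S ⊆ Finset.Icc (S.min' h0) (S.max' h0) := fun x hx =>
    Finset.mem_Icc.2 ⟨S.min'_le x hx, S.le_max' x hx⟩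
  have h3 := Finset.card_le_card h2
  rw [Nat.card_Icc] at h3
  have h4 : S.min' h0 ≤ S.max' h0 := S.min'_le _ (S.max'_mem h0)
  have h5 : S.card + S.min' h0 ≤ S.max' h0 + 1 := by omega
  have h6 : (S.card : ℝ) + S.min' h0 ≤ S.max' h0 + 1 := by exact_mod_cast h5
  linarith

lemma rpow_sub_rpow_ge {θ : ℝ} (hθ : 0 < θ) (hθ' : θ ≤ 1) {a b K : ℝ} (ha : 0 < a) (hab : a ≤ b)
    (hbK : b ≤ K) : θ * K ^ (θ - 1) * (b - a) ≤ b ^ θ - a ^ θ := by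
  have hc : ContinuousOn (fun x : ℝ => x ^ θ) (Set.Icc a b) :=
    fun x hx => (Real.continuousAt_rpow_const x θ (Or.inr hθ.le)).continuousWithinAt
  refine Convex.mul_sub_le_image_sub_of_le_deriv (convex_Icc a b) hc ?_ ?_ a
    (Set.left_mem_Icc.2 hab) b (Set.right_mem_Icc.2 hab) hab
  · intro x hx
    rw [interior_Icc] at hx
    exact (Real.differentiableAt_rpow_const_of_ne θ (by linarith [hx.1])).differentiableWithinAt
  · intro x hx
    rw [interior_Icc] at hx
    rw [Real.deriv_rpow_const]
    gcongr ?_ * ?_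
    exact Real.rpow_le_rpow_of_nonpos (by linarith [hx.1]) (by linarith [hx.2]) (by linarith)

lemma card_near_multiple_le (β θ : ℝ) (hβ : 0 < β) (hθ : 0 < θ) (hθ' : θ ≤ 1) :
    ∃ C > (0 : ℝ), ∀ (K e B : ℕ) (E : ℝ), 1 ≤ K → 1 ≤ e → 1 ≤ B → 1 ≤ E → 
      ∀ S : Finset ℕ, S ⊆ Finset.Icc 1 K → (∀ l ∈ S, ∃ D : ℕ, 1 ≤ D ∧ D ≤ B ∧ ∃ j : ℤ,
        |D * (β * (l : ℝ) ^ θ) - e * j| ≤ E) →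
      (S.card : ℝ) ≤ C * (B ^ 2 * E ^ 2) * (K / e + (K : ℝ) ^ (1 - θ)) := by
  classical
  refine ⟨(2 * β + 5) * (2 / (β * θ) + 1), by positivity, ?_⟩
  intro K e B E hK he hB hE S hS hl
  have hK0 : (0 : ℝ) < K := by exact_mod_cast hK
  have he0 : (0 : ℝ) < e := by exact_mod_cast he
  have hB0 : (1 : ℝ) ≤ B := by exact_mod_cast hB
  have hK1 : (1 : ℝ) ≤ K := by exact_mod_cast hK
  set J : ℕ := ⌊(B * (β * (K : ℝ) ^ θ) + E) / e⌋₊ with hJ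
  set f : ℕ → ℤ → Finset ℕ := fun D j => S.filter fun l => |D * (β * (l : ℝ) ^ θ) - e * j| ≤ E
  have hcov : S ⊆ (Finset.Icc 1 B ×ˢ Finset.Icc (-(J : ℤ)) J).biUnion (fun p => f p.1 p.2) := by
    intro l hlS
    obtain ⟨D, hD1, hDB, j, hj⟩ := hl l hlS
    have hlK : l ≤ K := (Finset.mem_Icc.1 (hS hlS)).2
    refine Finset.mem_biUnion.2 ⟨(D, j), ?_, Finset.mem_filter.2 ⟨hlS, hj⟩⟩
    have h1 : |(e : ℝ) * j| ≤ B * (β * (K : ℝ) ^ θ) + E := by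
      have h2 : (D : ℝ) * (β * (l : ℝ) ^ θ) ≤ B * (β * (K : ℝ) ^ θ) := by gcongr
      have h3 : 0 ≤ (D : ℝ) * (β * (l : ℝ) ^ θ) := by positivity
      rw [abs_le] at hj ⊢
      constructor <;> linarith [hj.1, hj.2]
    have h2 : (j.natAbs : ℝ) ≤ (B * (β * (K : ℝ) ^ θ) + E) / e := by
      rw [le_div_iff₀ he0]
      rw [abs_mul, abs_of_pos he0] at h1
      have : ((j.natAbs : ℕ) : ℝ) = |(j : ℝ)| := by rw [Nat.cast_natAbs, Int.cast_abs]
      rw [this]; linarith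
    have h3 : j.natAbs ≤ J := Nat.le_floor h2
    simp only [Finset.mem_product, Finset.mem_Icc]
    omega
  have hcard : ∀ p ∈ Finset.Icc 1 B ×ˢ Finset.Icc (-(J : ℤ)) J,
      ((f p.1 p.2).card : ℝ) ≤ (2 / (β * θ) + 1) * (E * (K : ℝ) ^ (1 - θ)) := by
    rintro ⟨D, j⟩ hp
    simp only [Finset.mem_product, Finset.mem_Icc] at hp
    have hD : (1 : ℝ) ≤ D := by exact_mod_cast hp.1.1
    have hEK : 1 ≤ E * (K : ℝ) ^ (1 - θ) :=
      one_le_mul_of_one_le_of_one_le hE (Real.one_le_rpow hK1 (by linarith))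
    refine (card_le_of_diam _ (2 / (β * θ) * (E * (K : ℝ) ^ (1 - θ))) (by positivity) ?_).trans ?_
    · intro a ha b hb hab
      have ha' := Finset.mem_filter.1 ha
      have hb' := Finset.mem_filter.1 hb
      have ha1 := Finset.mem_Icc.1 (hS ha'.1)
      have hb1 := Finset.mem_Icc.1 (hS hb'.1)
      have h1 := rpow_sub_rpow_ge hθ hθ' (a := a) (b := b) (K := K) (by exact_mod_cast ha1.1)
        (by exact_mod_cast hab) (by exact_mod_cast hb1.2)
      have h2 : (D : ℝ) * (β * ((b : ℝ) ^ θ - (a : ℝ) ^ θ)) ≤ 2 * E := by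
        have := abs_le.1 ha'.2
        have := abs_le.1 hb'.2
        dsimp only at *
        linarith
      have h0 : 0 ≤ θ * (K : ℝ) ^ (θ - 1) * ((b : ℝ) - a) := by
        have : (a : ℝ) ≤ b := by exact_mod_cast hab
        have : 0 ≤ (b : ℝ) - a := by linarith
        positivity
      have h3 : β * (θ * (K : ℝ) ^ (θ - 1) * ((b : ℝ) - a)) ≤ 2 * E := by
        calc _ ≤ β * ((b : ℝ) ^ θ - (a : ℝ) ^ θ) := by gcongr
          _ = 1 * (β * ((b : ℝ) ^ θ - (a : ℝ) ^ θ)) := by ring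
          _ ≤ D * (β * ((b : ℝ) ^ θ - (a : ℝ) ^ θ)) := by
            gcongr
            exact mul_nonneg hβ.le (h0.trans h1)
          _ ≤ _ := h2
      have h4 : (K : ℝ) ^ (θ - 1) * (K : ℝ) ^ (1 - θ) = 1 := by
        rw [← Real.rpow_add hK0]; simp
      calc (b : ℝ) - a = (β * (θ * (K : ℝ) ^ (θ - 1) * ((b : ℝ) - a))) *
              (K : ℝ) ^ (1 - θ) / (β * θ) := by
            rw [show (β * (θ * (K : ℝ) ^ (θ - 1) * ((b : ℝ) - a))) * (K : ℝ) ^ (1 - θ)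
              = β * θ * ((b : ℝ) - a) * ((K : ℝ) ^ (θ - 1) * (K : ℝ) ^ (1 - θ)) by ring, h4]
            field_simp
        _ ≤ (2 * E) * (K : ℝ) ^ (1 - θ) / (β * θ) := by gcongr
        _ = _ := by ring
    · linarith
  have h1 : (S.card : ℝ) ≤ (B * (2 * J + 1)) * ((2 / (β * θ) + 1) * (E * (K : ℝ) ^ (1 - θ))) := by
    calc (S.card : ℝ)
        ≤ ∑ p ∈ Finset.Icc 1 B ×ˢ Finset.Icc (-(J : ℤ)) J, ((f p.1 p.2).card : ℝ) := by
          exact_mod_cast (Finset.card_le_card hcov).trans Finset.card_biUnion_le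
      _ ≤ ∑ p ∈ Finset.Icc 1 B ×ˢ Finset.Icc (-(J : ℤ)) J,
          (2 / (β * θ) + 1) * (E * (K : ℝ) ^ (1 - θ)) := Finset.sum_le_sum hcard
      _ = _ := by
        rw [Finset.sum_const, Finset.card_product, Nat.card_Icc, Int.card_Icc, nsmul_eq_mul]
        have : ((J : ℤ) + 1 - -(J : ℤ)).toNat = 2 * J + 1 := by omega
        rw [this]; push_cast; simp
  have hJ' : (J : ℝ) ≤ (B * (β * (K : ℝ) ^ θ) + E) / e := Nat.floor_le (by positivity)
  have hKθ : (1 : ℝ) ≤ (K : ℝ) ^ θ := Real.one_le_rpow hK1 hθ.le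
  have h2 : 2 * (J : ℝ) + 1 ≤ (2 * β + 5) * (B * E) * ((K : ℝ) ^ θ / e + 1) := by
    have hBE : 1 ≤ B * E := one_le_mul_of_one_le_of_one_le hB0 hE
    have e1 : B * (β * (K : ℝ) ^ θ) + E ≤ (β + 1) * (B * E) * (K : ℝ) ^ θ := by
      have : B * (β * (K : ℝ) ^ θ) * 1 ≤ B * (β * (K : ℝ) ^ θ) * E := by gcongr
      have : 1 * E * 1 ≤ B * E * (K : ℝ) ^ θ := by gcongr
      nlinarith
    have e2 : (J : ℝ) ≤ (β + 1) * (B * E) * ((K : ℝ) ^ θ / e) := by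
      refine hJ'.trans ?_
      rw [← mul_div_assoc]
      gcongr
    have e3 : 0 ≤ (K : ℝ) ^ θ / e := by positivity
    have e4 : 0 ≤ (B * E) * ((K : ℝ) ^ θ / e) := by positivity
    nlinarith [mul_nonneg hβ.le (show (0 : ℝ) ≤ B * E by linarith)]
  have hKK : (K : ℝ) ^ θ * (K : ℝ) ^ (1 - θ) = K := by
    rw [← Real.rpow_add hK0]; simp
  calc (S.card : ℝ) ≤ _ := h1
    _ ≤ (B * ((2 * β + 5) * (B * E) * ((K : ℝ) ^ θ / e + 1))) *
        ((2 / (β * θ) + 1) * (E * (K : ℝ) ^ (1 - θ))) := by gcongr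
    _ = (2 * β + 5) * (2 / (β * θ) + 1) * (B ^ 2 * E ^ 2) *
        ((K : ℝ) ^ θ * (K : ℝ) ^ (1 - θ) / e + (K : ℝ) ^ (1 - θ)) := by ring
    _ = _ := by rw [hKK]

lemma card_le_sparse_add_crowded (S : Finset ℕ) (K M m : ℕ) (η : ℝ) (hη : 0 < η) (hη1 : η ≤ 1)
    (hM : 1 ≤ M) (hMK : M ≤ K) (hS : S ⊆ Finset.Icc 1 K) :
    (S.card : ℝ) ≤ 3 * m * (K * (M : ℝ) ^ (-η)) + ((S.filter fun s =>
      m + 1 ≤ (S.filter (fun i => s ≤ i ∧ i < s + ⌊(M : ℝ) ^ η⌋₊)).card).card : ℝ) := by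
  set H := ⌊(M : ℝ) ^ η⌋₊ with hHdef
  have hM1 : (1 : ℝ) ≤ M := by exact_mod_cast hM
  have hMK1 : (M : ℝ) ≤ K := by exact_mod_cast hMK
  have hpow : (1 : ℝ) ≤ (M : ℝ) ^ η := Real.one_le_rpow hM1 hη.le
  have hH : 1 ≤ H := Nat.le_floor (by simpa using hpow)
  have hH1 : (1 : ℝ) ≤ H := by exact_mod_cast hH
  have hsplit := Finset.card_filter_add_card_filter_not (s := S) (fun s =>
      m + 1 ≤ (S.filter (fun i => s ≤ i ∧ i < s + H)).card)
  have hsp := card_sparse_le (S.filter fun s =>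
      ¬ m + 1 ≤ (S.filter (fun i => s ≤ i ∧ i < s + H)).card) K H m hH
      ((Finset.filter_subset _ _).trans hS) (fun s hs => ⟨S, Finset.filter_subset _ _, by
        have := (Finset.mem_filter.1 hs).2
        omega⟩)
  have hneg : (M : ℝ) ^ (-η) * (M : ℝ) ^ η = 1 := by
    rw [← Real.rpow_add (by linarith)]; simp
  have hnpos : 0 < (M : ℝ) ^ (-η) := by positivity
  have h1 : ((K / H + 1 : ℕ) : ℝ) ≤ 3 * (K * (M : ℝ) ^ (-η)) := by
    have h2 : ((K / H : ℕ) : ℝ) ≤ (K : ℝ) / H := Nat.cast_div_le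
    have h3 : (M : ℝ) ^ η ≤ 2 * H := by
      have := Nat.lt_floor_add_one ((M : ℝ) ^ η)
      rw [← hHdef] at this
      linarith
    have h4 : (K : ℝ) / H ≤ 2 * (K * (M : ℝ) ^ (-η)) := by
      rw [div_le_iff₀ (by linarith)]
      have : (K : ℝ) * (M : ℝ) ^ (-η) * (M : ℝ) ^ η ≤ (K : ℝ) * (M : ℝ) ^ (-η) * (2 * H) := by
        gcongr
      rw [mul_assoc (K : ℝ), hneg] at this
      linarith
    have h5 : 1 ≤ (K * (M : ℝ) ^ (-η)) := by
      calc (1 : ℝ) ≤ (M : ℝ) ^ (1 - η) := Real.one_le_rpow hM1 (by linarith)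
        _ = M * (M : ℝ) ^ (-η) := by rw [sub_eq_add_neg, Real.rpow_add (by linarith), Real.rpow_one]
        _ ≤ _ := by gcongr
    push_cast
    linarith
  have h6 : (S.card : ℝ) = ((S.filter fun s =>
      m + 1 ≤ (S.filter (fun i => s ≤ i ∧ i < s + H)).card).card : ℝ) + ((S.filter fun s =>
      ¬ m + 1 ≤ (S.filter (fun i => s ≤ i ∧ i < s + H)).card).card : ℝ) := by
    exact_mod_cast hsplit.symm
  have h7 : ((S.filter fun s =>
      ¬ m + 1 ≤ (S.filter (fun i => s ≤ i ∧ i < s + H)).card).card : ℝ) ≤ 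
      m * (3 * (K * (M : ℝ) ^ (-η))) := by
    calc _ ≤ ((m * (K / H + 1) : ℕ) : ℝ) := by exact_mod_cast hsp
      _ = m * ((K / H + 1 : ℕ) : ℝ) := by push_cast; ring
      _ ≤ _ := by gcongr
  rw [h6]
  linarith

lemma card_pow_modEq_le (m : ℕ) (hm : 1 ≤ m) : ∃ C > (0 : ℝ), ∃ δ > (0 : ℝ), ∀ K e c : ℕ, 1 ≤ K →
    1 ≤ e → (((Finset.Icc 1 K).filter fun l => l ^ m ≡ c [MOD e]).card : ℝ) ≤
      C * (K * ((min e K : ℕ) : ℝ) ^ (-δ)) := by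
  refine ⟨3 * m, by positivity, 1 / (2 * (m * (m + 1))), by positivity, ?_⟩
  intro K e c hK he
  have hm1 : (1 : ℝ) ≤ m := by exact_mod_cast hm
  set η : ℝ := 1 / (2 * (m * (m + 1)))
  rcases he.eq_or_lt with he1 | he1
  · have : min e K = 1 := by omega
    rw [this]
    have h2 := Finset.card_filter_le (Finset.Icc 1 K) (fun l => l ^ m ≡ c [MOD e])
    rw [Nat.card_Icc, Nat.add_sub_cancel] at h2
    have h3 : (((Finset.Icc 1 K).filter fun l => l ^ m ≡ c [MOD e]).card : ℝ) ≤ K := by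
      exact_mod_cast h2
    simp only [Nat.cast_one, Real.one_rpow, mul_one]
    nlinarith
  set M := min e K with hMdef
  set S := (Finset.Icc 1 K).filter fun l => l ^ m ≡ c [MOD e] with hS
  have hM1 : 1 ≤ M := by omega
  have hη : 0 < η := by positivity
  have hη1 : η ≤ 1 := by
    rw [div_le_one (by positivity)]
    nlinarith
  have key := card_le_sparse_add_crowded S K M m η hη hη1 hM1 (min_le_right _ _)
    (Finset.filter_subset _ _)
  rw [Finset.filter_false_of_mem] at key
  · simpa using key
  intro s hs hcrowd
  obtain ⟨s', hs', hcard⟩ := Finset.exists_subset_card_eq hcrowd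
  have hmem : ∀ i ∈ s', i ^ m ≡ c [MOD e] ∧ s ≤ i ∧ i < s + ⌊(M : ℝ) ^ η⌋₊ := fun i hi => by
    have h1 := Finset.mem_filter.1 (hs' hi)
    exact ⟨(Finset.mem_filter.1 h1.1).2, h1.2⟩
  have hdvd := nodeDisc_dvd m hm e c s' hcard (fun i hi => (hmem i hi).1)
  have hH : 1 ≤ ⌊(M : ℝ) ^ η⌋₊ := Nat.le_floor (by
    simpa using Real.one_le_rpow (by exact_mod_cast hM1) hη.le)
  have hle := abs_prod_node_le s' s' subset_rfl m _ s hcard hH (fun i hi => (hmem i hi).2)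
  have h1 := Int.le_of_dvd (abs_pos.2 (nodeDisc_ne_zero s')) ((dvd_abs _ _).2 hdvd)
  have h2 : (e : ℝ) ≤ (⌊(M : ℝ) ^ η⌋₊ : ℝ) ^ (m * (m + 1)) := by exact_mod_cast h1.trans hle
  have h3 : (⌊(M : ℝ) ^ η⌋₊ : ℝ) ≤ (e : ℝ) ^ η := by
    refine (Nat.floor_le (by positivity)).trans ?_
    have : (M : ℝ) ≤ e := by exact_mod_cast min_le_left e K
    gcongr
  have he2 : (1 : ℝ) < e := by exact_mod_cast he1
  have h4 : (e : ℝ) ≤ (e : ℝ) ^ (1 / 2 : ℝ) := by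
    calc (e : ℝ) ≤ ((e : ℝ) ^ η) ^ (m * (m + 1)) := h2.trans (by gcongr)
      _ = (e : ℝ) ^ (η * ((m * (m + 1) : ℕ) : ℝ)) := by
        rw [← Real.rpow_natCast, ← Real.rpow_mul (by positivity)]
      _ = _ := by
        congr 1
        push_cast
        simp only [η]
        field_simp
  have h5 : (e : ℝ) ^ (1 / 2 : ℝ) < (e : ℝ) ^ (1 : ℝ) :=
    Real.rpow_lt_rpow_of_exponent_lt he2 (by norm_num)
  rw [Real.rpow_one] at h5
  linarith

lemma card_floor_rpow_modEq_le_of_nonint (m : ℕ) (hm : 1 ≤ m) (r : ℝ) (hr : (m : ℝ) < r)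
    (hr' : r ≤ m + 1) : ∃ C > (0 : ℝ), ∃ δ > (0 : ℝ), ∀ K e c : ℕ, 1 ≤ K →
    1 ≤ e → (((Finset.Icc 1 K).filter fun l : ℕ => ⌊(l : ℝ) ^ r⌋₊ ≡ c [MOD e]).card : ℝ) ≤
      C * (K * ((min e K : ℕ) : ℝ) ^ (-δ)) := by
  obtain ⟨β, hβ, C, hC, hnear⟩ := exists_near_multiple m hm r hr.le hr'
  set θ := r - m with hθdef
  have hθ : 0 < θ := by linarith
  have hθ1 : θ ≤ 1 := by linarith
  obtain ⟨C₂, hC₂, hcount⟩ := card_near_multiple_le β θ hβ hθ hθ1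
  set A := m * (m + 1)
  set A₂ := (m + 1) * (m + 1)
  set Q := 2 * A + 2 * A₂ with hQ
  have hQ1 : 1 ≤ Q := by simp only [hQ, A₂]; nlinarith
  have hQ1' : (1 : ℝ) ≤ Q := by exact_mod_cast hQ1
  set η : ℝ := θ / (2 * Q) with hηdef
  have hη : 0 < η := by positivity
  have hηθ : η ≤ θ / 2 := by
    rw [hηdef]
    gcongr
    linarith
  refine ⟨3 * m + 2 * (C₂ * (C + 1) ^ 2), by positivity, η, hη, ?_⟩
  intro K e c hK he
  set M := min e K with hMdef
  set S := (Finset.Icc 1 K).filter fun l : ℕ => ⌊(l : ℝ) ^ r⌋₊ ≡ c [MOD e] with hS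
  have hM1 : 1 ≤ M := by omega
  have hM1' : (1 : ℝ) ≤ M := by exact_mod_cast hM1
  have hMe : (M : ℝ) ≤ e := by exact_mod_cast min_le_left e K
  have hMK : (M : ℝ) ≤ K := by exact_mod_cast min_le_right e K
  have key := card_le_sparse_add_crowded S K M m η hη (by linarith) hM1 (min_le_right _ _)
    (Finset.filter_subset _ _)
  set H := ⌊(M : ℝ) ^ η⌋₊ with hHdef
  have hH : 1 ≤ H := Nat.le_floor (by simpa using Real.one_le_rpow hM1' hη.le)
  have hH1 : (1 : ℝ) ≤ H := by exact_mod_cast hH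
  have hbad := hcount K e (H ^ A) ((C + 1) * (H : ℝ) ^ A₂) hK he (Nat.one_le_pow _ _ hH)
    (one_le_mul_of_one_le_of_one_le (by linarith) (one_le_pow₀ hH1))
    (S.filter fun s => m + 1 ≤ (S.filter (fun i => s ≤ i ∧ i < s + H)).card)
    ((Finset.filter_subset _ _).trans (Finset.filter_subset _ _)) (by
      intro l hl
      have hl' := Finset.mem_filter.1 hl
      obtain ⟨s', hs', hcard⟩ := Finset.exists_subset_card_eq hl'.2
      obtain ⟨D, hD1, hD2, j, hj⟩ := hnear e c H l s' hH
        (Finset.mem_Icc.1 (Finset.mem_filter.1 hl'.1).1).1 hcard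
        (fun i hi => (Finset.mem_filter.1 (hs' hi)).2)
        (fun i hi => (Finset.mem_filter.1 (Finset.mem_filter.1 (hs' hi)).1).2)
      refine ⟨D, hD1, hD2, j, hj.trans ?_⟩
      gcongr
      linarith)
  have h1 : (H : ℝ) ^ Q ≤ (M : ℝ) ^ (θ / 2) := by
    calc (H : ℝ) ^ Q ≤ ((M : ℝ) ^ η) ^ Q := by
          gcongr
          exact Nat.floor_le (by positivity)
      _ = (M : ℝ) ^ (η * Q) := by rw [← Real.rpow_natCast, ← Real.rpow_mul (by positivity)]
      _ = _ := by
        congr 1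
        rw [hηdef]
        field_simp
  have h2 : (K : ℝ) / e + (K : ℝ) ^ (1 - θ) ≤ 2 * (K * (M : ℝ) ^ (-θ)) := by
    have e1 : (K : ℝ) / e ≤ K * (M : ℝ) ^ (-θ) := by
      rw [div_eq_mul_inv]
      gcongr
      rw [Real.rpow_neg (by positivity)]
      gcongr
      calc (M : ℝ) ^ θ ≤ (M : ℝ) ^ (1 : ℝ) := Real.rpow_le_rpow_of_exponent_le hM1' hθ1
        _ = M := Real.rpow_one _
        _ ≤ e := hMe
    have e2 : (K : ℝ) ^ (1 - θ) ≤ K * (M : ℝ) ^ (-θ) := by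
      rw [sub_eq_add_neg, Real.rpow_add (by linarith), Real.rpow_one]
      gcongr ?_ * ?_
      exact Real.rpow_le_rpow_of_nonpos (by linarith) hMK (by linarith)
    linarith
  have h3 : (M : ℝ) ^ (θ / 2) * (M : ℝ) ^ (-θ) ≤ (M : ℝ) ^ (-η) := by
    rw [← Real.rpow_add (by linarith)]
    exact Real.rpow_le_rpow_of_exponent_le hM1' (by linarith)
  have h4 : C₂ * (((H ^ A : ℕ) : ℝ) ^ 2 * ((C + 1) * (H : ℝ) ^ A₂) ^ 2) *
      ((K : ℝ) / e + (K : ℝ) ^ (1 - θ)) ≤ 2 * (C₂ * (C + 1) ^ 2) * (K * (M : ℝ) ^ (-η)) := by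
    have : C₂ * (((H ^ A : ℕ) : ℝ) ^ 2 * ((C + 1) * (H : ℝ) ^ A₂) ^ 2) = 
        C₂ * (C + 1) ^ 2 * (H : ℝ) ^ Q := by
      rw [hQ, pow_add, mul_comm 2 A, mul_comm 2 A₂, pow_mul, pow_mul]
      push_cast
      ring
    rw [this]
    calc _ ≤ C₂ * (C + 1) ^ 2 * (M : ℝ) ^ (θ / 2) * (2 * (K * (M : ℝ) ^ (-θ))) := by gcongr
      _ = 2 * (C₂ * (C + 1) ^ 2) * (K * ((M : ℝ) ^ (θ / 2) * (M : ℝ) ^ (-θ))) := by ring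
      _ ≤ _ := by gcongr
  rw [add_mul]
  linarith

/-- The values `⌊l ^ r⌋₊` do not concentrate in residue classes. -/
theorem card_floor_rpow_modEq_le (r : ℝ) (hr : 1 ≤ r) : ∃ C > (0 : ℝ), ∃ δ > (0 : ℝ),
    ∀ K e c : ℕ, 1 ≤ K → 1 ≤ e →
    (((Finset.Icc 1 K).filter fun l : ℕ => ⌊(l : ℝ) ^ r⌋₊ ≡ c [MOD e]).card : ℝ) ≤
      C * (K * ((min e K : ℕ) : ℝ) ^ (-δ)) := by
  have hm : 1 ≤ ⌊r⌋₊ := Nat.le_floor (by simpa using hr)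
  rcases (Nat.floor_le (by linarith : 0 ≤ r)).eq_or_lt with h | h
  · obtain ⟨C, hC, δ, hδ, H⟩ := card_pow_modEq_le ⌊r⌋₊ hm
    refine ⟨C, hC, δ, hδ, fun K e c hK he => ?_⟩
    convert H K e c hK he using 5 with l
    rw [← h, Real.rpow_natCast, ← Nat.cast_pow, Nat.floor_natCast, Nat.floor_natCast]
  · exact card_floor_rpow_modEq_le_of_nonint _ hm r h (Nat.lt_floor_add_one r).le

open ArithmeticFunction in
open scoped ArithmeticFunction.Moebius in
/-- Dual Möbius inversion on the divisors of `P`. -/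
theorem sum_moebius_div_of_dvd_dvd {P l : ℕ} (hP : P ≠ 0) (hl : l ∣ P) (y : ℕ → ℝ) :
    ∑ d ∈ P.divisors with l ∣ d, ∑ m ∈ P.divisors with d ∣ m, (μ (m / d) : ℝ) * y m = y l := by
  have hl0 : 0 < l := Nat.pos_of_dvd_of_pos hl (Nat.pos_of_ne_zero hP)
  have h1 : ∀ m ∈ P.divisors, ∑ d ∈ P.divisors with (l ∣ d ∧ d ∣ m), (μ (m / d) : ℝ) =
      if m = l then 1 else 0 := by
    intro m hm
    have hmP := Nat.dvd_of_mem_divisors hm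
    have hm0 : 0 < m := Nat.pos_of_dvd_of_pos hmP (Nat.pos_of_ne_zero hP)
    by_cases hlm : l ∣ m
    · obtain ⟨k, rfl⟩ := hlm
      have hk : 0 < k := Nat.pos_of_mul_pos_left hm0
      have : ∑ d ∈ P.divisors with (l ∣ d ∧ d ∣ l * k), (μ (l * k / d) : ℝ) =
          ∑ e ∈ k.divisors, (μ (k / e) : ℝ) := by
        symm
        refine Finset.sum_bij (fun e _ => l * e) ?_ ?_ ?_ ?_
        · intro e he
          have he := Nat.dvd_of_mem_divisors he
          simp only [Finset.mem_filter, Nat.mem_divisors]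
          have h2 := Nat.mul_dvd_mul_left l he
          exact ⟨⟨h2.trans hmP, hP⟩, Dvd.intro _ rfl, h2⟩
        · intro a _ b _ h
          exact Nat.eq_of_mul_eq_mul_left hl0 h
        · intro d hd
          simp only [Finset.mem_filter, Nat.mem_divisors] at hd
          obtain ⟨-, ⟨e, rfl⟩, h2⟩ := hd
          exact ⟨e, by simpa using ⟨Nat.dvd_of_mul_dvd_mul_left hl0 h2, hk.ne'⟩, rfl⟩
        · intro e _
          rw [Nat.mul_div_mul_left _ _ hl0]
      rw [this, Nat.sum_div_divisors k (fun e => (μ e : ℝ))]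
      have h3 := congrArg (fun f => f k) moebius_mul_coe_zeta
      simp only [coe_mul_zeta_apply, one_apply] at h3
      have h4 : ∑ e ∈ k.divisors, (μ e : ℝ) = ((∑ e ∈ k.divisors, μ e : ℤ) : ℝ) := by push_cast; rfl
      rw [h4, h3]
      have : l * k = l ↔ k = 1 := by
        constructor
        · intro h
          exact Nat.eq_of_mul_eq_mul_left hl0 (by simpa using h)
        · rintro rfl; simp
      simp [this]
    · rw [Finset.sum_eq_zero, if_neg]
      · rintro rfl; exact hlm dvd_rfl
      · intro d hd
        simp only [Finset.mem_filter] at hd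
        exact absurd (hd.2.1.trans hd.2.2) hlm
  calc _ = ∑ m ∈ P.divisors, ∑ d ∈ P.divisors with (l ∣ d ∧ d ∣ m), (μ (m / d) : ℝ) * y m := by
        rw [Finset.sum_filter]
        simp_rw [Finset.sum_filter, ← Finset.sum_filter]
        simp_rw [Finset.sum_filter, ite_and]
        rw [Finset.sum_comm]
        congr! 2 with d hd m hm
        split_ifs with h
        · rfl
        · simp
    _ = ∑ m ∈ P.divisors, (if m = l then 1 else 0) * y m := by
        refine Finset.sum_congr rfl fun m hm => ?_
        rw [← Finset.sum_mul, h1 m hm]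
    _ = y l := by
        simp [hl, hP]

namespace BoundingSieve
open ArithmeticFunction
open scoped ArithmeticFunction.Moebius

variable (s : BoundingSieve)

/-- The sum of Selberg terms up to `R`. -/
noncomputable def selbergSum (R : ℕ) : ℝ :=
  ∑ l ∈ s.prodPrimes.divisors with l ≤ R, s.selbergTerms l

/-- The diagonalised Selberg weights. -/
noncomputable def selbergDiag (R l : ℕ) : ℝ :=
  if l ≤ R then s.selbergTerms l * μ l / s.selbergSum R else 0

/-- The optimal Selberg weights. -/
noncomputable def selbergWt (R d : ℕ) : ℝ :=
  (s.nu d)⁻¹ * ∑ m ∈ s.prodPrimes.divisors with d ∣ m, (μ (m / d) : ℝ) * s.selbergDiag R m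

theorem selbergSum_pos {R : ℕ} (hR : 1 ≤ R) : 0 < s.selbergSum R := by
  refine Finset.sum_pos (fun l hl => ?_) ⟨1, ?_⟩
  · exact selbergTerms_pos (Nat.dvd_of_mem_divisors (Finset.mem_filter.mp hl).1)
  · simp [hR, prodPrimes_ne_zero]

theorem selbergWt_one {R : ℕ} (hR : 1 ≤ R) : s.selbergWt R 1 = 1 := by
  have hS := s.selbergSum_pos hR
  have : ∑ m ∈ s.prodPrimes.divisors with 1 ∣ m, (μ (m / 1) : ℝ) * s.selbergDiag R m = 1 := by
    have h1 : ∀ m ∈ s.prodPrimes.divisors, (μ (m / 1) : ℝ) * s.selbergDiag R m =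
        if m ≤ R then s.selbergTerms m / s.selbergSum R else 0 := by
      intro m hm
      have hsq := squarefree_of_mem_divisors_prodPrimes hm
      rw [selbergDiag, Nat.div_one]
      split_ifs
      · have : (μ m : ℝ) * μ m = 1 := by
          have := moebius_sq_eq_one_of_squarefree hsq
          rw [← sq]; exact_mod_cast this
        calc _ = ((μ m : ℝ) * μ m) * s.selbergTerms m / s.selbergSum R := by ring
          _ = _ := by rw [this, one_mul]
      · simp
    rw [Finset.filter_true_of_mem (by simp), Finset.sum_congr rfl h1, ← Finset.sum_filter,
      ← Finset.sum_div, ← selbergSum, div_self hS.ne']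
  rw [selbergWt, this, s.nu_mult.map_one]
  simp

theorem abs_selbergWt_le {R : ℕ} (hR : 1 ≤ R) {d : ℕ} (hd : d ∣ s.prodPrimes) :
    |s.selbergWt R d| ≤ if d ≤ R then (s.nu d)⁻¹ else 0 := by
  have hS := s.selbergSum_pos hR
  have hd0 : 0 < d := Nat.pos_of_dvd_of_pos hd (Nat.pos_of_ne_zero prodPrimes_ne_zero)
  have hb : ∀ m ∈ s.prodPrimes.divisors, |(μ (m / d) : ℝ) * s.selbergDiag R m| ≤
      if m ≤ R then s.selbergTerms m / s.selbergSum R else 0 := by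
    intro m hm
    have hg := selbergTerms_pos (Nat.dvd_of_mem_divisors hm)
    rw [abs_mul, selbergDiag]
    have hμ : ∀ k : ℕ, |(μ k : ℝ)| ≤ 1 := fun k => by exact_mod_cast abs_moebius_le_one
    split_ifs
    · rw [abs_div, abs_mul, abs_of_pos hg, abs_of_pos hS]
      calc _ ≤ 1 * (s.selbergTerms m * 1 / s.selbergSum R) := by
            gcongr <;> apply hμ
        _ = _ := by simp
    · simp
  rw [selbergWt, abs_mul, abs_of_pos (inv_pos.2 (nu_pos_of_dvd_prodPrimes hd))]
  split_ifs with h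
  · refine mul_le_of_le_one_right (inv_pos.2 (nu_pos_of_dvd_prodPrimes hd)).le ?_
    calc _ ≤ ∑ m ∈ s.prodPrimes.divisors with d ∣ m, |(μ (m / d) : ℝ) * s.selbergDiag R m| :=
          Finset.abs_sum_le_sum_abs _ _
      _ ≤ ∑ m ∈ s.prodPrimes.divisors, |(μ (m / d) : ℝ) * s.selbergDiag R m| :=
          Finset.sum_le_sum_of_subset_of_nonneg (Finset.filter_subset _ _)
            fun _ _ _ => abs_nonneg _
      _ ≤ _ := Finset.sum_le_sum hb
      _ = 1 := by
          rw [← Finset.sum_filter, ← Finset.sum_div, ← selbergSum, div_self hS.ne']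
  · rw [Finset.sum_eq_zero]
    · simp
    · intro m hm
      simp only [Finset.mem_filter, Nat.mem_divisors] at hm
      have : d ≤ m := Nat.le_of_dvd (Nat.pos_of_dvd_of_pos hm.1.1
        (Nat.pos_of_ne_zero prodPrimes_ne_zero)) hm.2
      rw [selbergDiag, if_neg (by omega), mul_zero]

theorem mainSum_selbergWt {R : ℕ} (hR : 1 ≤ R) :
    s.mainSum (lambdaSquared (s.selbergWt R)) = (s.selbergSum R)⁻¹ := by
  have hS := s.selbergSum_pos hR
  rw [mainSum_lambdaSquared_eq_sum_mul_sum_sq]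
  have h1 : ∀ l ∈ s.prodPrimes.divisors, (s.selbergTerms l)⁻¹ *
      (∑ d ∈ s.prodPrimes.divisors, if l ∣ d then s.nu d * s.selbergWt R d else 0) ^ 2 =
      if l ≤ R then s.selbergTerms l / (s.selbergSum R) ^ 2 else 0 := by
    intro l hl
    have hlP := Nat.dvd_of_mem_divisors hl
    have hsq := squarefree_of_mem_divisors_prodPrimes hl
    have hg := selbergTerms_pos hlP
    rw [← Finset.sum_filter]
    have : ∑ d ∈ s.prodPrimes.divisors with l ∣ d, s.nu d * s.selbergWt R d =
        s.selbergDiag R l := by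
      rw [← sum_moebius_div_of_dvd_dvd prodPrimes_ne_zero hlP (s.selbergDiag R)]
      refine Finset.sum_congr rfl fun d hd => ?_
      rw [selbergWt, ← mul_assoc, mul_inv_cancel₀, one_mul]
      exact nu_ne_zero (Nat.dvd_of_mem_divisors (Finset.mem_filter.mp hd).1)
    rw [this, selbergDiag]
    split_ifs
    · have : (μ l : ℝ) ^ 2 = 1 := by exact_mod_cast moebius_sq_eq_one_of_squarefree hsq
      rw [div_pow, mul_pow, this]
      field_simp
    · simp
  rw [Finset.sum_congr rfl h1, ← Finset.sum_filter, ← Finset.sum_div, ← selbergSum]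
  field_simp

theorem errSum_selbergWt_le {R : ℕ} (hR : 1 ≤ R)
    (hnu : ∀ d, d ∣ s.prodPrimes → (s.nu d)⁻¹ ≤ d)
    (hrem : ∀ d, d ∣ s.prodPrimes → |s.rem d| ≤ d) :
    s.errSum (lambdaSquared (s.selbergWt R)) ≤ (R : ℝ) ^ 6 := by
  set P := s.prodPrimes
  set w := s.selbergWt R
  have hw : ∀ d ∈ P.divisors, |w d| ≤ if d ≤ R then (d : ℝ) else 0 := by
    intro d hd
    refine (s.abs_selbergWt_le hR (Nat.dvd_of_mem_divisors hd)).trans ?_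
    split_ifs
    · exact hnu d (Nat.dvd_of_mem_divisors hd)
    · rfl
  have h1 : ∀ d ∈ P.divisors, |lambdaSquared w d| * |s.rem d| ≤
      ∑ d1 ∈ P.divisors, ∑ d2 ∈ P.divisors,
        if d = d1.lcm d2 then |w d1| * |w d2| * (d1 * d2) else 0 := by
    intro d hd
    have hdP := Nat.dvd_of_mem_divisors hd
    have hsub : d.divisors ⊆ P.divisors := Nat.divisors_subset_of_dvd prodPrimes_ne_zero hdP
    calc |lambdaSquared w d| * |s.rem d| ≤ (∑ d1 ∈ d.divisors, ∑ d2 ∈ d.divisors,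
          if d = d1.lcm d2 then |w d1| * |w d2| else 0) * |s.rem d| := by
          gcongr
          rw [lambdaSquared]
          refine (Finset.abs_sum_le_sum_abs _ _).trans (Finset.sum_le_sum fun d1 _ => ?_)
          refine (Finset.abs_sum_le_sum_abs _ _).trans (Finset.sum_le_sum fun d2 _ => ?_)
          split_ifs <;> simp [abs_mul]
      _ = ∑ d1 ∈ d.divisors, ∑ d2 ∈ d.divisors,
          if d = d1.lcm d2 then |w d1| * |w d2| * |s.rem d| else 0 := by
          simp_rw [Finset.sum_mul, ite_mul, zero_mul]
      _ ≤ ∑ d1 ∈ d.divisors, ∑ d2 ∈ d.divisors,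
          if d = d1.lcm d2 then |w d1| * |w d2| * (d1 * d2) else 0 := by
          refine Finset.sum_le_sum fun d1 hd1 => Finset.sum_le_sum fun d2 hd2 => ?_
          split_ifs with h
          · gcongr
            refine (hrem d hdP).trans ?_
            rw [h, ← Nat.cast_mul]
            have h1 := Nat.pos_of_mem_divisors hd1
            have h2 := Nat.pos_of_mem_divisors hd2
            exact_mod_cast Nat.le_of_dvd (Nat.mul_pos h1 h2) (Nat.lcm_dvd_mul d1 d2)
          · rfl
      _ ≤ ∑ d1 ∈ d.divisors, ∑ d2 ∈ P.divisors,
          if d = d1.lcm d2 then |w d1| * |w d2| * (d1 * d2) else 0 := by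
          refine Finset.sum_le_sum fun d1 hd1 =>
            Finset.sum_le_sum_of_subset_of_nonneg hsub fun _ _ _ => ?_
          split_ifs <;> positivity
      _ ≤ _ := by
          refine Finset.sum_le_sum_of_subset_of_nonneg hsub fun _ _ _ =>
            Finset.sum_nonneg fun _ _ => ?_
          split_ifs <;> positivity
  have h2 : ∑ d ∈ P.divisors, |w d| * d ≤ (R : ℝ) ^ 3 := by
    calc ∑ d ∈ P.divisors, |w d| * d ≤ ∑ d ∈ P.divisors, if d ≤ R then (d : ℝ) * d else 0 := by
          refine Finset.sum_le_sum fun d hd => ?_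
          have := hw d hd
          split_ifs at this ⊢
          · gcongr
          · have : |w d| = 0 := le_antisymm this (abs_nonneg _)
            simp [this]
      _ = ∑ d ∈ P.divisors with d ≤ R, (d : ℝ) * d := by rw [← Finset.sum_filter]
      _ ≤ ∑ d ∈ Finset.Icc 1 R, (R : ℝ) * R := by
          refine (Finset.sum_le_sum_of_subset_of_nonneg (t := Finset.Icc 1 R) ?_
            fun _ _ _ => by positivity).trans (Finset.sum_le_sum fun d hd => ?_)
          · intro d hd
            simp only [Finset.mem_filter] at hd
            exact Finset.mem_Icc.2 ⟨Nat.pos_of_mem_divisors hd.1, hd.2⟩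
          · have := (Finset.mem_Icc.1 hd).2
            gcongr
      _ = (R : ℝ) ^ 3 := by simp; ring
  calc s.errSum (lambdaSquared w) ≤ ∑ d ∈ P.divisors, ∑ d1 ∈ P.divisors, ∑ d2 ∈ P.divisors,
        (if d = d1.lcm d2 then |w d1| * |w d2| * (d1 * d2) else 0) := Finset.sum_le_sum h1
    _ = ∑ d1 ∈ P.divisors, ∑ d2 ∈ P.divisors, ∑ d ∈ P.divisors,
        (if d = d1.lcm d2 then |w d1| * |w d2| * (d1 * d2) else 0) := by
        rw [Finset.sum_comm]
        refine Finset.sum_congr rfl fun d1 _ => Finset.sum_comm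
    _ = ∑ d1 ∈ P.divisors, ∑ d2 ∈ P.divisors, (|w d1| * d1) * (|w d2| * d2) := by
        refine Finset.sum_congr rfl fun d1 hd1 => Finset.sum_congr rfl fun d2 hd2 => ?_
        rw [Finset.sum_ite_eq_of_mem']
        · ring
        · exact Nat.mem_divisors.2 ⟨Nat.lcm_dvd (Nat.dvd_of_mem_divisors hd1)
            (Nat.dvd_of_mem_divisors hd2), prodPrimes_ne_zero⟩
    _ = (∑ d ∈ P.divisors, |w d| * d) * ∑ d ∈ P.divisors, |w d| * d := by
        rw [Finset.sum_mul_sum]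
    _ ≤ (R : ℝ) ^ 3 * (R : ℝ) ^ 3 := by
        gcongr
    _ = _ := by ring

/-- Selberg's upper bound sieve. -/
theorem siftedSum_le_selberg {R : ℕ} (hR : 1 ≤ R)
    (hnu : ∀ d, d ∣ s.prodPrimes → (s.nu d)⁻¹ ≤ d)
    (hrem : ∀ d, d ∣ s.prodPrimes → |s.rem d| ≤ d) :
    s.siftedSum ≤ s.totalMass / s.selbergSum R + (R : ℝ) ^ 6 := by
  refine (siftedSum_le_mainSum_errSum_of_upperMoebius _
    (upperMoebius_lambdaSquared _ (s.selbergWt_one hR))).trans ?_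
  rw [mainSum_selbergWt s hR, ← div_eq_mul_inv]
  gcongr
  exact s.errSum_selbergWt_le hR hnu hrem

end BoundingSieve

/-- Counting a periodic predicate on an initial segment. -/
theorem abs_card_periodic_sub_le (p : ℕ → Prop) [DecidablePred p] {d : ℕ} (hd : 0 < d)
    (hp : Function.Periodic p d) (x : ℕ) :
    |(((Finset.Icc 1 x).filter p).card : ℝ) - (Nat.count p d : ℝ) / d * x| ≤ d := by
  have h1 : ∀ q : ℕ, ((Finset.Ico 1 (1 + q * d)).filter p).card = q * Nat.count p d := by
    intro q
    induction q with
    | zero => simp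
    | succ q ih =>
      have h2 : Finset.Ico 1 (1 + (q + 1) * d) =
          Finset.Ico 1 (1 + q * d) ∪ Finset.Ico (1 + q * d) (1 + q * d + d) := by
        rw [Finset.Ico_union_Ico_eq_Ico (by omega) (by omega)]
        congr 1; ring
      rw [h2, Finset.filter_union, Finset.card_union_of_disjoint, ih,
        Nat.filter_Ico_card_eq_of_periodic _ _ _ hp]
      · ring
      · exact Finset.disjoint_filter_filter (Finset.Ico_disjoint_Ico_consecutive _ _ _)
  have hx := Nat.div_add_mod' x d
  have hr := Nat.mod_lt x hd
  set q := x / d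
  set r := x % d
  have h3 : Finset.Icc 1 x = Finset.Ico 1 (1 + q * d) ∪ Finset.Ico (1 + q * d) (1 + x) := by
    rw [Finset.Ico_union_Ico_eq_Ico (by omega) (by omega)]
    ext; simp; omega
  have h4 : ((Finset.Icc 1 x).filter p).card =
      q * Nat.count p d + ((Finset.Ico (1 + q * d) (1 + x)).filter p).card := by
    rw [h3, Finset.filter_union, Finset.card_union_of_disjoint, h1]
    exact Finset.disjoint_filter_filter (Finset.Ico_disjoint_Ico_consecutive _ _ _)
  have h5 : ((Finset.Ico (1 + q * d) (1 + x)).filter p).card ≤ r := by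
    refine (Finset.card_filter_le _ _).trans ?_
    simp; omega
  have h6 : Nat.count p d ≤ d := Nat.count_le _
  rw [h4]
  set c := Nat.count p d
  set u := ((Finset.Ico (1 + q * d) (1 + x)).filter p).card
  have hd' : (0 : ℝ) < d := by exact_mod_cast hd
  have h7 : (c : ℝ) / d * x = q * c + c * (r / d) := by
    rw [← hx]; push_cast; field_simp
  have h8 : (r : ℝ) / d ≤ 1 := (div_le_one hd').2 (by exact_mod_cast hr.le)
  have h9 : (c : ℝ) * (r / d) ≤ d := by
    calc (c : ℝ) * (r / d) ≤ d * 1 := by gcongr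
      _ = d := mul_one _
  have h10 : (u : ℝ) ≤ d := by exact_mod_cast h5.trans hr.le
  have h11 : 0 ≤ (c : ℝ) * (r / d) := by positivity
  rw [h7, abs_le]
  push_cast
  constructor <;> linarith [(Nat.cast_nonneg u : (0 : ℝ) ≤ u)]

/-- The number of roots of `z (z + h)` modulo `d`. -/
noncomputable def twinRootCount (h d : ℕ) : ℕ := Nat.card {z : ZMod d // z * (z + h) = 0}

theorem twinRootCount_mul (h : ℕ) {m n : ℕ} (hmn : m.Coprime n) :
    twinRootCount h (m * n) = twinRootCount h m * twinRootCount h n := by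
  rw [twinRootCount, twinRootCount, twinRootCount, ← Nat.card_prod]
  let e := ZMod.chineseRemainder hmn
  refine Nat.card_congr ?_
  refine (e.toEquiv.subtypeEquiv (q := fun w : ZMod m × ZMod n =>
    w.1 * (w.1 + h) = 0 ∧ w.2 * (w.2 + h) = 0)
    fun z => ?_).trans (Equiv.subtypeProdEquivProd (p := fun a : ZMod m => a * (a + h) = 0)
      (q := fun b : ZMod n => b * (b + h) = 0))
  rw [← e.map_eq_zero_iff, map_mul, map_add, map_natCast, Prod.ext_iff]
  rfl

theorem twinRootCount_prime (h : ℕ) {p : ℕ} (hp : p.Prime) :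
    twinRootCount h p = if p ∣ h then 1 else 2 := by
  have := Fact.mk hp
  rw [twinRootCount]
  have h1 : {z : ZMod p | z * (z + h) = 0} = {0, -(h : ZMod p)} := by
    ext z
    simp [mul_eq_zero, add_eq_zero_iff_eq_neg]
  have h2 : Nat.card {z : ZMod p // z * (z + h) = 0} =
      ({0, -(h : ZMod p)} : Set (ZMod p)).ncard := by
    rw [← h1]; rfl
  rw [h2]
  split_ifs with hd
  · rw [(ZMod.natCast_eq_zero_iff h p).2 hd]
    simp
  · rw [Set.ncard_pair]
    intro h0
    exact hd ((ZMod.natCast_eq_zero_iff h p).1 (neg_eq_zero.1 h0.symm))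

theorem twinRootCount_pos (h : ℕ) {d : ℕ} (hd : 0 < d) : 1 ≤ twinRootCount h d := by
  have : NeZero d := ⟨hd.ne'⟩
  exact Nat.card_pos_iff.2 ⟨⟨⟨0, by simp⟩⟩, inferInstance⟩

theorem count_dvd_eq_twinRootCount (h : ℕ) {d : ℕ} (hd : 0 < d) :
    Nat.count (fun n => d ∣ n * (n + h)) d = twinRootCount h d := by
  have : NeZero d := ⟨hd.ne'⟩
  rw [Nat.count_eq_card_filter_range, twinRootCount, Nat.card_eq_fintype_card,
    Fintype.card_subtype]
  refine Finset.card_bij (fun n _ => (n : ZMod d)) ?_ ?_ ?_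
  · intro n hn
    simp only [Finset.mem_filter, Finset.mem_range, Finset.mem_univ, true_and] at hn ⊢
    have := (ZMod.natCast_eq_zero_iff (n * (n + h)) d).2 hn.2
    exact_mod_cast this
  · intro a ha b hb hab
    simp only [Finset.mem_filter, Finset.mem_range] at ha hb
    have := (ZMod.natCast_eq_natCast_iff a b d).1 hab
    exact Nat.ModEq.eq_of_lt_of_lt this ha.1 hb.1
  · intro z hz
    simp only [Finset.mem_filter, Finset.mem_univ, true_and] at hz
    refine ⟨z.val, ?_, by simp⟩
    simp only [Finset.mem_filter, Finset.mem_range]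
    refine ⟨ZMod.val_lt z, (ZMod.natCast_eq_zero_iff _ d).1 ?_⟩
    push_cast
    simpa using hz

/-- The sieve problem for pairs of primes with difference `h`. -/
noncomputable def twinSieve (h x R : ℕ) (hh : Even h) : BoundingSieve where
  support := (Finset.Icc 1 x).image fun n => n * (n + h)
  prodPrimes := primorial R
  prodPrimes_squarefree := squarefree_primorial R
  weights := 1
  weights_nonneg _ := zero_le_one
  totalMass := x
  nu := ⟨fun d => (twinRootCount h d : ℝ) / d, by simp⟩
  nu_mult := by
    refine ⟨?_, fun {m n} hmn => ?_⟩
    · have : twinRootCount h 1 = 1 := by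
        rw [twinRootCount, Nat.card_eq_one_iff_unique]
        exact ⟨inferInstance, ⟨⟨0, by simp⟩⟩⟩
      simp [this]
    · simp only [ArithmeticFunction.coe_mk]
      rw [twinRootCount_mul h hmn]
      push_cast
      rw [mul_div_mul_comm]
  nu_pos_of_prime p hp _ := by
    simp only [ArithmeticFunction.coe_mk]
    have h1 := twinRootCount_pos h hp.pos
    have h2 := hp.pos
    positivity
  nu_lt_one_of_prime p hp _ := by
    simp only [ArithmeticFunction.coe_mk]
    rw [twinRootCount_prime h hp, div_lt_one (by exact_mod_cast hp.pos)]
    norm_cast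
    split_ifs with hd
    · exact hp.one_lt
    · refine lt_of_le_of_ne hp.two_le ?_
      rintro rfl
      exact hd hh.two_dvd

theorem twinSieve_rem_le (h x R : ℕ) (hh : Even h) (d : ℕ) (hd : 0 < d) :
    |(twinSieve h x R hh).rem d| ≤ d := by
  have h1 : (twinSieve h x R hh).multSum d =
      (((Finset.Icc 1 x).filter fun n => d ∣ n * (n + h)).card : ℝ) := by
    simp only [BoundingSieve.multSum, twinSieve, Pi.one_apply]
    rw [Finset.sum_image]
    · simp
    · intro a ha b hb hab
      simp only [] at hab
      by_contra hne
      rcases lt_or_gt_of_ne hne with hlt | hlt <;> nlinarith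
  have h2 : (twinSieve h x R hh).nu d * (twinSieve h x R hh).totalMass =
      (Nat.count (fun n => d ∣ n * (n + h)) d : ℝ) / d * x := by
    rw [count_dvd_eq_twinRootCount h hd]
    simp [twinSieve]
  rw [BoundingSieve.rem, h1, h2]
  refine abs_card_periodic_sub_le _ hd ?_ x
  intro n
  have : (n + d) * (n + d + h) = n * (n + h) + d * (2 * n + d + h) := by ring
  simp only [this, eq_iff_iff]
  exact (Nat.dvd_add_left (Dvd.intro _ rfl))

/-- The singular sum attached to the difference `h`. -/
noncomputable def twinSum (h R : ℕ) : ℝ :=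
  ∑ l ∈ (Finset.Icc 1 R).filter Squarefree, ∏ p ∈ l.primeFactors, (if p ∣ h then 1 else 2) / (p : ℝ)

theorem twinSum_pos (h : ℕ) {R : ℕ} (hR : 1 ≤ R) : 0 < twinSum h R := by
  refine Finset.sum_pos (fun l hl => Finset.prod_pos fun p hp => ?_) ⟨1, by simp [hR]⟩
  have := (Nat.prime_of_mem_primeFactors hp).pos
  split_ifs <;> positivity

theorem twinSum_le_selbergSum (h x R : ℕ) (hh : Even h) :
    twinSum h R ≤ (twinSieve h x R hh).selbergSum R := by
  have hsub : (Finset.Icc 1 R).filter Squarefree ⊆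
      (twinSieve h x R hh).prodPrimes.divisors.filter (· ≤ R) := by
    intro l hl
    simp only [Finset.mem_filter, Finset.mem_Icc] at hl
    simp only [Finset.mem_filter, Nat.mem_divisors]
    exact ⟨⟨hl.2.dvd_primorial.trans (primorial_dvd_primorial hl.1.2),
      BoundingSieve.prodPrimes_ne_zero⟩, hl.1.2⟩
  rw [twinSum, BoundingSieve.selbergSum]
  refine (Finset.sum_le_sum fun l hl => ?_).trans (Finset.sum_le_sum_of_subset_of_nonneg hsub
    fun l hl _ => (BoundingSieve.selbergTerms_pos (Nat.dvd_of_mem_divisors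
      (Finset.mem_filter.1 hl).1)).le)
  have hlP := Nat.dvd_of_mem_divisors (Finset.mem_filter.1 (hsub hl)).1
  rw [BoundingSieve.selbergTerms_apply, ← BoundingSieve.prod_primeFactors_nu hlP]
  have h1 : ∏ p ∈ l.primeFactors, (if p ∣ h then 1 else 2) / (p : ℝ) =
      ∏ p ∈ l.primeFactors, (twinSieve h x R hh).nu p := by
    refine Finset.prod_congr rfl fun p hp => ?_
    simp only [twinSieve, ArithmeticFunction.coe_mk]
    rw [twinRootCount_prime h (Nat.prime_of_mem_primeFactors hp)]
    push_cast
    rfl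
  rw [h1]
  refine le_mul_of_one_le_right (Finset.prod_nonneg fun p hp => ?_) ?_
  · exact ((twinSieve h x R hh).nu_pos_of_prime p (Nat.prime_of_mem_primeFactors hp)
      ((Nat.dvd_of_mem_primeFactors hp).trans hlP)).le
  · refine (Finset.prod_const_one (s := l.primeFactors)).symm.trans_le
      (Finset.prod_le_prod (fun _ _ => zero_le_one) fun p hp => ?_)
    have h2 := (twinSieve h x R hh).nu_pos_of_prime p (Nat.prime_of_mem_primeFactors hp)
      ((Nat.dvd_of_mem_primeFactors hp).trans hlP)
    have h3 := (twinSieve h x R hh).nu_lt_one_of_prime p (Nat.prime_of_mem_primeFactors hp)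
      ((Nat.dvd_of_mem_primeFactors hp).trans hlP)
    rw [one_le_inv₀] <;> linarith

theorem card_twin_primes_le_selberg (h x R : ℕ) (hh : Even h) (hR : 1 ≤ R) :
    (((Finset.Icc 1 x).filter fun n => n.Prime ∧ (n + h).Prime).card : ℝ) ≤
      x / twinSum h R + (R : ℝ) ^ 6 + R := by
  set s := twinSieve h x R hh with hs
  have hpos : ∀ d, d ∣ s.prodPrimes → 0 < d := fun d hd =>
    Nat.pos_of_dvd_of_pos hd (Nat.pos_of_ne_zero BoundingSieve.prodPrimes_ne_zero)
  have h1 : s.siftedSum ≤ s.totalMass / s.selbergSum R + (R : ℝ) ^ 6 := by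
    refine s.siftedSum_le_selberg hR (fun d hd => ?_)
      (fun d hd => twinSieve_rem_le h x R hh d (hpos d hd))
    simp only [hs, twinSieve, ArithmeticFunction.coe_mk]
    have h2 : (1 : ℝ) ≤ twinRootCount h d := by exact_mod_cast twinRootCount_pos h (hpos d hd)
    rw [inv_div]
    exact div_le_self (Nat.cast_nonneg _) h2
  have h2 : s.totalMass / s.selbergSum R ≤ x / twinSum h R := by
    have : s.totalMass = x := rfl
    rw [this]
    have := twinSum_pos h hR
    gcongr
    exact twinSum_le_selbergSum h x R hh
  have h3 : (((Finset.Icc 1 x).filter fun n => n.Prime ∧ (n + h).Prime).card : ℝ) ≤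
      s.siftedSum + R := by
    have h4 : s.siftedSum = (((Finset.Icc 1 x).filter fun n =>
        (primorial R).Coprime (n * (n + h))).card : ℝ) := by
      simp only [BoundingSieve.siftedSum, hs, twinSieve, Pi.one_apply]
      rw [Finset.sum_image]
      · simp
      · intro a ha b hb hab
        simp only [] at hab
        by_contra hne
        rcases lt_or_gt_of_ne hne with hlt | hlt <;> nlinarith
    rw [h4]
    have h5 : (Finset.Icc 1 x).filter (fun n => n.Prime ∧ (n + h).Prime) ⊆
        (Finset.Icc 1 x).filter (fun n => (primorial R).Coprime (n * (n + h))) ∪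
          Finset.Icc 1 R := by
      intro n hn
      simp only [Finset.mem_filter, Finset.mem_Icc, Finset.mem_union] at hn ⊢
      by_cases hnR : n ≤ R
      · exact Or.inr ⟨hn.1.1, hnR⟩
      · refine Or.inl ⟨hn.1, Nat.Coprime.mul_right ?_ ?_⟩
        · rw [Nat.coprime_comm, hn.2.1.coprime_iff_not_dvd, hn.2.1.dvd_primorial_iff]
          exact hnR
        · rw [Nat.coprime_comm, hn.2.2.coprime_iff_not_dvd, hn.2.2.dvd_primorial_iff]
          omega
    have h6 := (Finset.card_le_card h5).trans (Finset.card_union_le _ _)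
    simp only [Nat.card_Icc, Nat.add_sub_cancel] at h6
    exact_mod_cast h6
  linarith

theorem sum_le_sum_of_forall_exists_preimage {α β : Type*} {A : Finset α} {B : Finset β}
    {f : α → ℝ} {g : β → ℝ} (i : β → α) (h : ∀ a ∈ A, ∃ b ∈ B, i b = a ∧ f a ≤ g b)
    (hg : ∀ b ∈ B, 0 ≤ g b) : ∑ a ∈ A, f a ≤ ∑ b ∈ B, g b := by
  classical
  rcases A.eq_empty_or_nonempty with rfl | ⟨a₀, ha₀⟩
  · simpa using Finset.sum_nonneg hg
  have : Nonempty β := ⟨(h a₀ ha₀).choose⟩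
  choose! j hj using h
  calc ∑ a ∈ A, f a ≤ ∑ a ∈ A, g (j a) := Finset.sum_le_sum fun a ha => (hj a ha).2.2
    _ = ∑ b ∈ A.image j, g b := by
        rw [Finset.sum_image]
        intro a ha b hb hab
        rw [← (hj a ha).2.1, hab, (hj b hb).2.1]
    _ ≤ ∑ b ∈ B, g b := by
        refine Finset.sum_le_sum_of_subset_of_nonneg ?_ fun b hb _ => hg b hb
        intro b hb
        obtain ⟨a, ha, rfl⟩ := Finset.mem_image.1 hb
        exact (hj a ha).1

theorem sum_Icc_inv_sq_le_two (M : ℕ) : ∑ b ∈ Finset.Icc 1 M, ((b : ℝ) ^ 2)⁻¹ ≤ 2 := by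
  have h := sum_Ioo_inv_sq_le (α := ℝ) 0 (M + 1)
  have h2 : Finset.Ioo 0 (M + 1) = Finset.Icc 1 M := by ext; simp; omega
  rw [h2] at h
  simpa using h

theorem log_add_one_le_sum_squarefree_inv (M : ℕ) :
    Real.log (M + 1) ≤ 2 * ∑ c ∈ (Finset.Icc 1 M).filter Squarefree, (c : ℝ)⁻¹ := by
  have h1 : Real.log (M + 1) ≤ ∑ a ∈ Finset.Icc 1 M, (a : ℝ)⁻¹ := by
    have := log_add_one_le_harmonic M
    rw [harmonic_eq_sum_Icc] at this
    push_cast at this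
    exact this
  refine h1.trans ?_
  calc ∑ a ∈ Finset.Icc 1 M, (a : ℝ)⁻¹ ≤
      ∑ q ∈ Finset.Icc 1 M ×ˢ (Finset.Icc 1 M).filter Squarefree,
        ((q.1 : ℝ) ^ 2)⁻¹ * (q.2 : ℝ)⁻¹ := by
        refine sum_le_sum_of_forall_exists_preimage (fun q => q.1 ^ 2 * q.2) ?_
          fun _ _ => by positivity
        intro a ha
        rw [Finset.mem_Icc] at ha
        obtain ⟨c, b, hc, hb, rfl, hsq⟩ := Nat.sq_mul_squarefree_of_pos (n := a) (by omega)
        refine ⟨(b, c), ?_, rfl, ?_⟩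
        · simp only [Finset.mem_product, Finset.mem_Icc, Finset.mem_filter]
          have : b ≤ b ^ 2 * c := by nlinarith [Nat.mul_pos hb hc]
          have : c ≤ b ^ 2 * c := Nat.le_mul_of_pos_left _ (by positivity)
          exact ⟨⟨hb, by omega⟩, ⟨hc, by omega⟩, hsq⟩
        · push_cast
          rw [mul_inv]
    _ = (∑ b ∈ Finset.Icc 1 M, ((b : ℝ) ^ 2)⁻¹) *
        ∑ c ∈ (Finset.Icc 1 M).filter Squarefree, (c : ℝ)⁻¹ := by
        rw [Finset.sum_mul_sum, Finset.sum_product]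
    _ ≤ _ := by
        gcongr
        exact sum_Icc_inv_sq_le_two M

theorem prod_two_div_eq_card_divisors {n : ℕ} (hn : Squarefree n) :
    ∏ p ∈ n.primeFactors, 2 / (p : ℝ) = n.divisors.card * (n : ℝ)⁻¹ := by
  rw [Finset.prod_div_distrib, ← Nat.cast_prod, Nat.prod_primeFactors_of_squarefree hn,
    Nat.card_divisors hn.ne_zero, div_eq_mul_inv]
  congr 1
  push_cast
  refine Finset.prod_congr rfl fun p hp => ?_
  have h1 := Nat.prime_of_mem_primeFactors hp
  have h2 := hn.natFactorization_le_one p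
  have h3 := h1.factorization_pos_of_dvd hn.ne_zero (Nat.dvd_of_mem_primeFactors hp)
  have : n.factorization p = 1 := by omega
  rw [this]; norm_num

theorem sq_sum_squarefree_inv_le (M : ℕ) :
    (∑ c ∈ (Finset.Icc 1 M).filter Squarefree, (c : ℝ)⁻¹) ^ 2 ≤
      2 * ∑ n ∈ (Finset.Icc 1 (M ^ 2)).filter Squarefree, ∏ p ∈ n.primeFactors, 2 / (p : ℝ) := by
  set B := Finset.Icc 1 M ×ˢ
    ((Finset.Icc 1 (M ^ 2)).filter Squarefree).sigma (fun n => n.divisors) with hB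
  calc _ = ∑ q ∈ (Finset.Icc 1 M).filter Squarefree ×ˢ (Finset.Icc 1 M).filter Squarefree,
        (q.1 : ℝ)⁻¹ * (q.2 : ℝ)⁻¹ := by
        rw [sq, Finset.sum_mul_sum, Finset.sum_product]
    _ ≤ ∑ q ∈ B, ((q.1 : ℝ) ^ 2)⁻¹ * (q.2.1 : ℝ)⁻¹ := by
        refine sum_le_sum_of_forall_exists_preimage
          (fun q => (q.1 * q.2.2, q.1 * (q.2.1 / q.2.2))) ?_ fun _ _ => by positivity
        rintro ⟨a, b⟩ hab
        simp only [Finset.mem_product, Finset.mem_Icc, Finset.mem_filter] at hab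
        obtain ⟨⟨⟨ha, haM⟩, hasq⟩, ⟨⟨hb, hbM⟩, hbsq⟩⟩ := hab
        obtain ⟨g, a', b', hg, hcop, hae, hbe⟩ := Nat.exists_coprime' (m := a) (n := b)
          (Nat.gcd_pos_of_pos_left _ ha)
        have ha' : 0 < a' := Nat.pos_of_mul_pos_right (hae ▸ ha)
        have hb' : 0 < b' := Nat.pos_of_mul_pos_right (hbe ▸ hb)
        have ha'a : a' ≤ a := hae ▸ Nat.le_mul_of_pos_right _ hg
        have hb'b : b' ≤ b := hbe ▸ Nat.le_mul_of_pos_right _ hg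
        have hga : g ≤ a := hae ▸ Nat.le_mul_of_pos_left _ ha'
        refine ⟨(g, ⟨a' * b', a'⟩), ?_, ?_, ?_⟩
        · simp only [hB, Finset.mem_product, Finset.mem_Icc, Finset.mem_filter, Finset.mem_sigma,
            Nat.mem_divisors]
          refine ⟨⟨hg, by omega⟩, ⟨⟨Nat.mul_pos ha' hb', ?_⟩, ?_⟩, Dvd.intro _ rfl,
            (Nat.mul_pos ha' hb').ne'⟩
          · rw [sq]; exact Nat.mul_le_mul (by omega) (by omega)
          · rw [Nat.squarefree_mul_iff]
            exact ⟨hcop, hasq.squarefree_of_dvd (hae ▸ Dvd.intro _ rfl),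
              hbsq.squarefree_of_dvd (hbe ▸ Dvd.intro _ rfl)⟩
        · simp only [Nat.mul_div_cancel_left _ ha']
          rw [hae, hbe, mul_comm, mul_comm b']
        · simp only []
          rw [hae, hbe, ← mul_inv, ← mul_inv]
          push_cast
          apply le_of_eq
          ring
    _ = (∑ b ∈ Finset.Icc 1 M, ((b : ℝ) ^ 2)⁻¹) *
        ∑ n ∈ (Finset.Icc 1 (M ^ 2)).filter Squarefree, ∏ p ∈ n.primeFactors, 2 / (p : ℝ) := by
        rw [hB, Finset.sum_product, Finset.sum_mul]
        refine Finset.sum_congr rfl fun b _ => ?_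
        simp only []
        rw [← Finset.mul_sum, Finset.sum_sigma]
        congr 1
        refine Finset.sum_congr rfl fun n hn => ?_
        rw [prod_two_div_eq_card_divisors (Finset.mem_filter.1 hn).2]
        simp
    _ ≤ _ := by
        gcongr
        exact sum_Icc_inv_sq_le_two M

theorem sum_prod_two_div_le_twinSum_mul {h R : ℕ} (hh : 0 < h) :
    ∑ n ∈ (Finset.Icc 1 R).filter Squarefree, ∏ p ∈ n.primeFactors, 2 / (p : ℝ) ≤
      twinSum h R * ∏ p ∈ h.primeFactors, (1 + 1 / (p : ℝ)) := by
  set g : ℕ → ℝ := fun p => (if p ∣ h then 1 else 2) / (p : ℝ) with hg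
  set u : ℕ → ℝ := fun p => (if p ∣ h then 1 else 0) / (p : ℝ) with hu
  have hg0 : ∀ p, 0 ≤ g p := fun p => by simp only [hg]; split_ifs <;> positivity
  have h1 : ∀ n : ℕ, ∏ p ∈ n.primeFactors, 2 / (p : ℝ) =
      ∑ s ∈ n.primeFactors.powerset with s ⊆ h.primeFactors,
        (∏ p ∈ s, 1 / (p : ℝ)) * ∏ p ∈ n.primeFactors \ s, g p := by
    intro n
    have : ∀ p ∈ n.primeFactors, 2 / (p : ℝ) = u p + g p := by
      intro p _
      simp only [hu, hg]
      split_ifs <;> ring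
    rw [Finset.prod_congr rfl this, Finset.prod_add, Finset.sum_filter]
    refine Finset.sum_congr rfl fun s hs => ?_
    split_ifs with hsub
    · congr 1
      refine Finset.prod_congr rfl fun p hp => ?_
      simp only [hu]
      rw [if_pos (Nat.dvd_of_mem_primeFactors (hsub hp))]
    · obtain ⟨p, hp, hp'⟩ := Finset.not_subset.1 hsub
      rw [Finset.prod_eq_zero hp, zero_mul]
      simp only [hu]
      rw [if_neg, zero_div]
      intro hd
      exact hp' (Nat.mem_primeFactors.2
        ⟨Nat.prime_of_mem_primeFactors (Finset.mem_powerset.1 hs hp), hd, hh.ne'⟩)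
  calc _ = ∑ q ∈ ((Finset.Icc 1 R).filter Squarefree).sigma
          (fun n => n.primeFactors.powerset.filter (· ⊆ h.primeFactors)),
        (∏ p ∈ q.2, 1 / (p : ℝ)) * ∏ p ∈ q.1.primeFactors \ q.2, g p := by
        rw [Finset.sum_sigma]
        exact Finset.sum_congr rfl fun n _ => h1 n
    _ ≤ ∑ q ∈ ((Finset.Icc 1 R).filter Squarefree) ×ˢ h.primeFactors.powerset,
        (∏ p ∈ q.2, 1 / (p : ℝ)) * ∏ p ∈ q.1.primeFactors, g p := by
        refine sum_le_sum_of_forall_exists_preimage (fun q => ⟨q.1 * ∏ p ∈ q.2, p, q.2⟩) ?_ ?_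
        · rintro ⟨n, s⟩ hns
          simp only [Finset.mem_sigma, Finset.mem_filter, Finset.mem_Icc,
            Finset.mem_powerset] at hns
          obtain ⟨⟨⟨hn, hnR⟩, hsq⟩, hs, hsh⟩ := hns
          have hmul : (∏ p ∈ n.primeFactors \ s, p) * ∏ p ∈ s, p = n := by
            rw [Finset.prod_sdiff hs, Nat.prod_primeFactors_of_squarefree hsq]
          set m := ∏ p ∈ n.primeFactors \ s, p with hm
          have hmn : m ∣ n := Dvd.intro _ hmul
          have hpf : m.primeFactors = n.primeFactors \ s := by
            rw [hm]
            refine Nat.primeFactors_prod fun p hp => ?_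
            exact Nat.prime_of_mem_primeFactors (Finset.mem_sdiff.1 hp).1
          refine ⟨(m, s), ?_, ?_, ?_⟩
          · simp only [Finset.mem_product, Finset.mem_filter, Finset.mem_Icc, Finset.mem_powerset]
            exact ⟨⟨⟨Nat.pos_of_dvd_of_pos hmn hn, (Nat.le_of_dvd hn hmn).trans hnR⟩,
              hsq.squarefree_of_dvd hmn⟩, hsh⟩
          · simp only [hmul]
          · simp only [hpf]; rfl
        · intro q _
          exact mul_nonneg (Finset.prod_nonneg fun _ _ => by positivity)
            (Finset.prod_nonneg fun p _ => hg0 p)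
    _ = _ := by
        rw [Finset.prod_one_add, twinSum, Finset.sum_mul_sum, Finset.sum_product]
        refine Finset.sum_congr rfl fun n _ => Finset.sum_congr rfl fun s _ => ?_
        rw [mul_comm]

theorem log_sq_le_twinSum_mul {h : ℕ} (hh : 0 < h) (R : ℕ) :
    Real.log (R + 1) ^ 2 ≤ 32 * (twinSum h R * ∏ p ∈ h.primeFactors, (1 + 1 / (p : ℝ))) := by
  set M := Nat.sqrt R with hM
  have h1 := log_add_one_le_sum_squarefree_inv M
  have h2 := sq_sum_squarefree_inv_le M
  have h3 := sum_prod_two_div_le_twinSum_mul (R := R) hh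
  have h4 : ∑ n ∈ (Finset.Icc 1 (M ^ 2)).filter Squarefree, ∏ p ∈ n.primeFactors, 2 / (p : ℝ) ≤
      ∑ n ∈ (Finset.Icc 1 R).filter Squarefree, ∏ p ∈ n.primeFactors, 2 / (p : ℝ) := by
    refine Finset.sum_le_sum_of_subset_of_nonneg (Finset.filter_subset_filter _
      (Finset.Icc_subset_Icc_right (Nat.sqrt_le' R))) fun n _ _ =>
      Finset.prod_nonneg fun _ _ => by positivity
  have h5 : Real.log (R + 1) ≤ 2 * Real.log (M + 1) := by
    rw [show (2 : ℝ) = (2 : ℕ) by norm_num, ← Real.log_pow]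
    refine Real.log_le_log (by positivity) ?_
    have := Nat.lt_succ_sqrt' R
    have : R + 1 ≤ (M + 1) ^ 2 := this
    exact_mod_cast this
  have h6 : 0 ≤ Real.log (R + 1 : ℝ) := Real.log_nonneg (by
    have : (0 : ℝ) ≤ R := Nat.cast_nonneg _
    linarith)
  set Q := ∑ c ∈ (Finset.Icc 1 M).filter Squarefree, (c : ℝ)⁻¹
  have h7 : Real.log (R + 1 : ℝ) ^ 2 ≤ (4 * Q) ^ 2 := by
    gcongr; linarith
  nlinarith

/-- The upper bound for the number of prime pairs with given difference. -/
theorem card_twin_primes_le : ∃ C > (0 : ℝ), ∀ h x : ℕ, 2 ≤ x → 0 < h → Even h →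
    (((Finset.Icc 1 x).filter fun n => n.Prime ∧ (n + h).Prime).card : ℝ) ≤
      C * (x / Real.log x ^ 2 * ∏ p ∈ h.primeFactors, (1 + 1 / (p : ℝ))) := by
  refine ⟨32 * 144 + 32, by norm_num, fun h x hx hh he => ?_⟩
  have hx' : (2 : ℝ) ≤ x := by exact_mod_cast hx
  have hlog : 0 < Real.log x := Real.log_pos (by linarith)
  set R := ⌊(x : ℝ) ^ (1 / 12 : ℝ)⌋₊ with hRdef
  have hR : 1 ≤ R := Nat.le_floor (by simpa using Real.one_le_rpow (by linarith) (by norm_num))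
  have hRle : (R : ℝ) ≤ (x : ℝ) ^ (1 / 12 : ℝ) := Nat.floor_le (by positivity)
  have hRlt : (x : ℝ) ^ (1 / 12 : ℝ) ≤ R + 1 := (Nat.lt_floor_add_one _).le
  have hS := twinSum_pos h hR
  set S := twinSum h R
  set F := ∏ p ∈ h.primeFactors, (1 + 1 / (p : ℝ)) with hF
  have hF1 : 1 ≤ F := by
    refine (Finset.prod_const_one (s := h.primeFactors)).symm.trans_le
      (Finset.prod_le_prod (fun _ _ => zero_le_one) fun p _ => ?_)
    have : 0 ≤ 1 / (p : ℝ) := by positivity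
    linarith
  have h1 := card_twin_primes_le_selberg h x R he hR
  have h2 := log_sq_le_twinSum_mul hh R
  have h3 : Real.log x ≤ 12 * Real.log (R + 1) := by
    have := Real.log_le_log (by positivity) hRlt
    rw [Real.log_rpow (by linarith)] at this
    linarith
  have h4 : Real.log x ^ 2 ≤ 144 * Real.log (R + 1) ^ 2 := by
    calc Real.log x ^ 2 ≤ (12 * Real.log (R + 1)) ^ 2 := by gcongr
      _ = _ := by ring
  have h5 : x / S ≤ 32 * 144 * (x / Real.log x ^ 2 * F) := by
    have : Real.log x ^ 2 ≤ 32 * 144 * (S * F) := by linarith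
    rw [div_le_iff₀ hS]
    calc (x : ℝ) = x / Real.log x ^ 2 * Real.log x ^ 2 := by field_simp
      _ ≤ x / Real.log x ^ 2 * (32 * 144 * (S * F)) := by gcongr
      _ = _ := by ring
  have h6 : (R : ℝ) ^ 6 + R ≤ 32 * (x / Real.log x ^ 2 * F) := by
    have hr6 : (R : ℝ) ^ 6 ≤ (x : ℝ) ^ (1 / 2 : ℝ) := by
      calc (R : ℝ) ^ 6 ≤ ((x : ℝ) ^ (1 / 12 : ℝ)) ^ 6 := by gcongr
        _ = _ := by rw [← Real.rpow_natCast, ← Real.rpow_mul (by linarith)]; norm_num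
    have hr1 : (R : ℝ) ≤ (R : ℝ) ^ 6 := le_self_pow₀ (by exact_mod_cast hR) (by norm_num)
    have hl : Real.log x ≤ 4 * (x : ℝ) ^ (1 / 4 : ℝ) := by
      have := Real.log_le_rpow_div (x := x) (by linarith) (ε := 1 / 4) (by norm_num)
      linarith
    have hl2 : Real.log x ^ 2 ≤ 16 * (x : ℝ) ^ (1 / 2 : ℝ) := by
      calc Real.log x ^ 2 ≤ (4 * (x : ℝ) ^ (1 / 4 : ℝ)) ^ 2 := by gcongr
        _ = 16 * ((x : ℝ) ^ (1 / 4 : ℝ)) ^ 2 := by ring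
        _ = _ := by
          congr 1
          rw [← Real.rpow_natCast, ← Real.rpow_mul (by linarith)]; norm_num
    have hxx : (x : ℝ) ^ (1 / 2 : ℝ) * (x : ℝ) ^ (1 / 2 : ℝ) = x := by
      rw [← Real.rpow_add (by linarith)]; norm_num
    have h7 : (x : ℝ) ^ (1 / 2 : ℝ) ≤ 16 * (x / Real.log x ^ 2) := by
      rw [← mul_div_assoc, le_div_iff₀ (by positivity)]
      calc _ ≤ (x : ℝ) ^ (1 / 2 : ℝ) * (16 * (x : ℝ) ^ (1 / 2 : ℝ)) := by gcongr
        _ = 16 * ((x : ℝ) ^ (1 / 2 : ℝ) * (x : ℝ) ^ (1 / 2 : ℝ)) := by ring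
        _ = _ := by rw [hxx]
    have h8 : x / Real.log x ^ 2 ≤ x / Real.log x ^ 2 * F :=
      le_mul_of_one_le_right (by positivity) hF1
    linarith
  linarith

theorem card_filter_prime_Icc (n : ℕ) :
    ((Finset.Icc 1 n).filter Nat.Prime).card = n.primeCounting := by
  rw [← Nat.primesLE_eq_filter_Icc_one, Nat.primesLE_card_eq_primeCounting]

theorem primeCounting_le_mul_div_log : ∃ C > (0 : ℝ), ∀ N : ℕ, 2 ≤ N →
    (N.primeCounting : ℝ) ≤ C * (N / Real.log N) := by
  refine ⟨2 * Real.log 4 + 2, by positivity, fun N hN => ?_⟩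
  have hN' : (2 : ℝ) ≤ N := by exact_mod_cast hN
  have h := Chebyshev.pi_le_log4_mul_div (x := N) (by linarith)
  rw [Nat.floor_natCast] at h
  have hl : 0 < Real.log N := Real.log_pos (by linarith)
  rw [Real.log_sqrt (by linarith)] at h
  have h1 : Real.log N ≤ 2 * √N := by
    have := Real.log_le_rpow_div (x := N) (by linarith) (ε := 1 / 2) (by norm_num)
    rw [← Real.sqrt_eq_rpow] at this
    linarith
  have h2 : √N ≤ 2 * (N / Real.log N) := by
    rw [← mul_div_assoc, le_div_iff₀ hl]
    calc √N * Real.log N ≤ √N * (2 * √N) := by gcongr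
      _ = 2 * (√N * √N) := by ring
      _ = _ := by rw [Real.mul_self_sqrt (by linarith)]
  have h3 : Real.log 4 * N / (Real.log N / 2) = 2 * Real.log 4 * (N / Real.log N) := by
    field_simp
  rw [h3] at h
  linarith

theorem eventually_mul_div_log_le_primeCounting : ∃ c > (0 : ℝ), ∀ᶠ N : ℕ in atTop,
    c * (N / Real.log N) ≤ (N.primeCounting : ℝ) := by
  refine ⟨1 / 4, by norm_num, ?_⟩
  have h1 : ∀ᶠ N : ℕ in atTop, ‖Real.log ((N + 1 : ℕ) : ℝ)‖ ≤ 1 / 8 * ‖((N + 1 : ℕ) : ℝ)‖ :=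
    ((tendsto_natCast_atTop_atTop (R := ℝ)).comp (tendsto_add_atTop_nat 1)).eventually
      (Real.isLittleO_log_id_atTop.bound (by norm_num : (0 : ℝ) < 1 / 8))
  filter_upwards [h1, eventually_ge_atTop 2] with N hN hN2
  have h2 := Chebyshev.pi_ge N
  refine le_trans ?_ h2
  have hN' : (2 : ℝ) ≤ N := by exact_mod_cast hN2
  have hl : 0 < Real.log N := Real.log_pos (by linarith)
  rw [← mul_div_assoc]
  gcongr
  have h3 := (le_abs_self _).trans hN
  rw [Real.norm_of_nonneg (by positivity)] at h3
  push_cast at h3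
  have := Real.log_two_gt_d9
  nlinarith

theorem eventually_primeCounting_le_mul {ε : ℝ} (hε : 0 < ε) : ∀ᶠ N : ℕ in atTop,
    (N.primeCounting : ℝ) ≤ ε * N := by
  obtain ⟨C, hC, H⟩ := primeCounting_le_mul_div_log
  have h1 : ∀ᶠ N : ℕ in atTop, C / ε ≤ Real.log N :=
    (Real.tendsto_log_atTop.comp tendsto_natCast_atTop_atTop).eventually_ge_atTop _
  filter_upwards [h1, eventually_ge_atTop 2] with N hN hN2
  refine (H N hN2).trans ?_
  have hl : 0 < Real.log N := Real.log_pos (by exact_mod_cast hN2)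
  rw [← mul_div_assoc, div_le_iff₀ hl]
  rw [div_le_iff₀ hε] at hN
  have : (0 : ℝ) ≤ N := Nat.cast_nonneg N
  nlinarith

theorem prod_one_add_inv_le_of_subset {S T : Finset ℕ} (h : S ⊆ T) :
    ∏ p ∈ S, (1 + 1 / (p : ℝ)) ≤ ∏ p ∈ T, (1 + 1 / (p : ℝ)) := by
  rw [← Finset.prod_sdiff h]
  refine le_mul_of_one_le_left (Finset.prod_nonneg fun _ _ => by positivity) ?_
  refine (Finset.prod_const_one (s := T \ S)).symm.trans_le
    (Finset.prod_le_prod (fun _ _ => zero_le_one) fun p _ => ?_)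
  have : 0 ≤ 1 / (p : ℝ) := by positivity
  linarith

theorem sum_primes_two_pow_le {η : ℝ} (hη : 0 < η) : ∃ C : ℝ, 0 ≤ C ∧ ∀ J : ℕ,
    ∑ p ∈ (Finset.Icc 1 (2 ^ J)).filter Nat.Prime, 1 / (p : ℝ) ≤ C + η * J := by
  have h1 := (tendsto_pow_atTop_atTop_of_one_lt (r := 2) (by norm_num)).eventually
    (eventually_primeCounting_le_mul (half_pos hη))
  obtain ⟨J₀, hJ₀⟩ := eventually_atTop.1 h1
  set G : ℕ → ℝ := fun J => ∑ p ∈ (Finset.Icc 1 (2 ^ J)).filter Nat.Prime, 1 / (p : ℝ) with hG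
  have hmono : ∀ J, G J ≤ G (J + 1) := by
    intro J
    refine Finset.sum_le_sum_of_subset_of_nonneg (Finset.filter_subset_filter _
      (Finset.Icc_subset_Icc_right (Nat.pow_le_pow_right (by norm_num) (by omega)))) ?_
    intros; positivity
  have hstep : ∀ J, J₀ ≤ J → G (J + 1) ≤ G J + η := by
    intro J hJ
    have h2 : (Finset.Icc 1 (2 ^ (J + 1))).filter Nat.Prime =
        (Finset.Icc 1 (2 ^ J)).filter Nat.Prime ∪
        (Finset.Ioc (2 ^ J) (2 ^ (J + 1))).filter Nat.Prime := by
      rw [← Finset.filter_union]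
      congr 1
      ext a
      have : 2 ^ (J + 1) = 2 * 2 ^ J := by ring
      have : 0 < 2 ^ J := by positivity
      simp only [Finset.mem_Icc, Finset.mem_union, Finset.mem_Ioc]
      omega
    have h3 : ∑ p ∈ (Finset.Ioc (2 ^ J) (2 ^ (J + 1))).filter Nat.Prime, 1 / (p : ℝ) ≤ η := by
      calc _ ≤ ∑ p ∈ (Finset.Ioc (2 ^ J) (2 ^ (J + 1))).filter Nat.Prime, 1 / (2 ^ J : ℝ) := by
            refine Finset.sum_le_sum fun p hp => ?_
            have := (Finset.mem_Ioc.1 (Finset.mem_filter.1 hp).1).1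
            gcongr
            exact_mod_cast this.le
        _ ≤ ((2 ^ (J + 1)).primeCounting : ℝ) * (1 / (2 ^ J : ℝ)) := by
            rw [Finset.sum_const, nsmul_eq_mul]
            gcongr
            rw [← card_filter_prime_Icc]
            refine Finset.card_le_card (Finset.filter_subset_filter _ ?_)
            intro a ha
            rw [Finset.mem_Ioc] at ha
            rw [Finset.mem_Icc]
            omega
        _ ≤ (η / 2 * ((2 ^ (J + 1) : ℕ) : ℝ)) * (1 / (2 ^ J : ℝ)) := by
            gcongr
            exact hJ₀ (J + 1) (by omega)
        _ = η := by push_cast; rw [pow_succ]; field_simp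
    simp only [hG]
    rw [h2, Finset.sum_union]
    · linarith
    · refine Finset.disjoint_filter_filter (Finset.disjoint_left.2 fun a ha hb => ?_)
      rw [Finset.mem_Icc] at ha
      rw [Finset.mem_Ioc] at hb
      omega
  have hG0 : ∀ J, 0 ≤ G J := fun J => Finset.sum_nonneg fun _ _ => by positivity
  have hm : Monotone G := monotone_nat_of_le_succ hmono
  refine ⟨G J₀, hG0 _, fun J => ?_⟩
  rcases le_total J J₀ with h | h
  · have := hm h
    have : 0 ≤ η * J := by positivity
    change G J ≤ _
    linarith
  · induction J, h using Nat.le_induction with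
    | base =>
      have : 0 ≤ η * J₀ := by positivity
      change G J₀ ≤ _
      linarith
    | succ J hJ ih =>
      have := hstep J hJ
      change G (J + 1) ≤ _
      change G J ≤ _ at ih
      push_cast
      linarith

/-- The product of `1 + 1 / p` over primes grows slower than any power. -/
theorem prod_primes_one_add_inv_le {η : ℝ} (hη : 0 < η) : ∃ C > (0 : ℝ), ∀ y : ℕ, 1 ≤ y →
    ∏ p ∈ (Finset.Icc 1 y).filter Nat.Prime, (1 + 1 / (p : ℝ)) ≤ C * (y : ℝ) ^ η := by
  have hl2 : 0 < Real.log 2 := Real.log_pos (by norm_num)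
  obtain ⟨C, hC, H⟩ := sum_primes_two_pow_le (mul_pos hη hl2)
  refine ⟨Real.exp C * 2 ^ η, by positivity, fun y hy => ?_⟩
  set J := Nat.log 2 y + 1 with hJ
  have h1 : y ≤ 2 ^ J := (Nat.lt_pow_succ_log_self (by norm_num) y).le
  have h2 : 2 ^ J ≤ 2 * y := by
    rw [hJ, pow_succ, mul_comm]
    exact Nat.mul_le_mul_left 2 (Nat.pow_log_le_self 2 (by omega))
  calc _ ≤ ∏ p ∈ (Finset.Icc 1 (2 ^ J)).filter Nat.Prime, (1 + 1 / (p : ℝ)) := by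
        exact prod_one_add_inv_le_of_subset (Finset.filter_subset_filter _
          (Finset.Icc_subset_Icc_right h1))
    _ ≤ ∏ p ∈ (Finset.Icc 1 (2 ^ J)).filter Nat.Prime, Real.exp (1 / (p : ℝ)) := by
        refine Finset.prod_le_prod (fun _ _ => by positivity) fun p _ => ?_
        rw [add_comm]
        exact Real.add_one_le_exp _
    _ = Real.exp (∑ p ∈ (Finset.Icc 1 (2 ^ J)).filter Nat.Prime, 1 / (p : ℝ)) :=
        (Real.exp_sum _ _).symm
    _ ≤ Real.exp (C + η * Real.log 2 * J) := Real.exp_le_exp.2 (H J)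
    _ = Real.exp C * ((2 ^ J : ℕ) : ℝ) ^ η := by
        rw [Real.exp_add]
        congr 1
        push_cast
        rw [← Real.rpow_natCast, ← Real.rpow_mul (by norm_num), Real.rpow_def_of_pos (by norm_num)]
        congr 1
        ring
    _ ≤ Real.exp C * (2 * y) ^ η := by
        gcongr
        exact_mod_cast h2
    _ = _ := by
        rw [Real.mul_rpow (by norm_num) (by positivity)]
        ring

theorem prod_one_add_inv_large_le {S : Finset ℕ} {k L : ℕ} (hL : 1 ≤ L) (hS : S.card ≤ k)
    (h : ∀ p ∈ S, L ≤ p) : ∏ p ∈ S, (1 + 1 / (p : ℝ)) ≤ Real.exp (k / L) := by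
  have hL' : (0 : ℝ) < L := by exact_mod_cast hL
  calc _ ≤ ∏ p ∈ S, Real.exp (1 / (L : ℝ)) := by
        refine Finset.prod_le_prod (fun _ _ => by positivity) fun p hp => ?_
        have h1 : 1 / (p : ℝ) ≤ 1 / L := by
          have := h p hp
          gcongr
        have := Real.add_one_le_exp (1 / (L : ℝ))
        linarith
    _ = Real.exp (S.card * (1 / L)) := by
        rw [Finset.prod_const, ← Real.exp_nat_mul]
    _ ≤ _ := by
        rw [mul_one_div]
        gcongr

/-- A set of at most `k` primes has a small product of `1 + 1 / p`. -/
theorem prod_one_add_inv_le_of_card_le {η : ℝ} (hη : 0 < η) : ∃ C > (0 : ℝ), ∀ k : ℕ, 1 ≤ k →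
    ∀ S : Finset ℕ, (∀ p ∈ S, p.Prime) → S.card ≤ k →
    ∏ p ∈ S, (1 + 1 / (p : ℝ)) ≤ C * (k : ℝ) ^ η := by
  obtain ⟨C, hC, H⟩ := prod_primes_one_add_inv_le hη
  refine ⟨C * Real.exp 1, by positivity, fun k hk S hS hSk => ?_⟩
  have h1 := H k hk
  have hk' : (0 : ℝ) < k := by exact_mod_cast hk
  rw [← Finset.prod_filter_mul_prod_filter_not S (· ≤ k)]
  have h2 : ∏ p ∈ S with p ≤ k, (1 + 1 / (p : ℝ)) ≤ C * (k : ℝ) ^ η := by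
    refine le_trans ?_ h1
    refine prod_one_add_inv_le_of_subset fun p hp => ?_
    rw [Finset.mem_filter] at hp
    rw [Finset.mem_filter, Finset.mem_Icc]
    exact ⟨⟨(hS p hp.1).one_lt.le, hp.2⟩, hS p hp.1⟩
  have h3 : ∏ p ∈ S with ¬ p ≤ k, (1 + 1 / (p : ℝ)) ≤ Real.exp 1 := by
    have := prod_one_add_inv_large_le (S := S.filter (fun p => ¬ p ≤ k)) (k := k) hk
      ((Finset.card_filter_le _ _).trans hSk) fun p hp => by
        have := (Finset.mem_filter.1 hp).2
        omega
    rwa [div_self hk'.ne'] at this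
  calc _ ≤ (C * (k : ℝ) ^ η) * Real.exp 1 := by gcongr
    _ = _ := by ring

theorem card_primeFactors_le_of_le_two_pow {n k : ℕ} (hn : n ≠ 0) (h : n ≤ 2 ^ k) :
    n.primeFactors.card ≤ k := by
  have h1 : 2 ^ n.primeFactors.card ≤ n := by
    calc 2 ^ n.primeFactors.card = ∏ _p ∈ n.primeFactors, 2 := by simp
      _ ≤ ∏ p ∈ n.primeFactors, p :=
          Finset.prod_le_prod' fun p hp => (Nat.prime_of_mem_primeFactors hp).two_le
      _ ≤ n := Nat.le_of_dvd (Nat.pos_of_ne_zero hn) (Nat.prod_primeFactors_dvd n)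
  exact (Nat.pow_le_pow_iff_right (by norm_num)).1 (h1.trans h)

theorem sum_divisors_inv_eq_prod {n : ℕ} (hn : Squarefree n) :
    ∑ d ∈ n.divisors, 1 / (d : ℝ) = ∏ p ∈ n.primeFactors, (1 + 1 / (p : ℝ)) := by
  let f : ArithmeticFunction ℝ := ⟨fun d => 1 / (d : ℝ), by simp⟩
  have hf : f.IsMultiplicative := ⟨by simp [f], fun {m n} _ => by simp [f, mul_comm]⟩
  exact (hf.prodPrimeFactors_one_add_of_squarefree hn).symm

theorem orderOf_two_pos {d : ℕ} (hd : Odd d) : 0 < orderOf (2 : ZMod d) := by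
  rw [orderOf_pos_iff, isOfFinOrder_iff_pow_eq_one]
  refine ⟨d.totient, Nat.totient_pos.2 hd.pos, ?_⟩
  have h := Nat.ModEq.pow_totient (x := 2) (n := d) (Nat.coprime_two_left.2 hd)
  have h2 := (ZMod.natCast_eq_natCast_iff _ _ _).2 h
  push_cast at h2
  exact h2

theorem dvd_two_pow_orderOf_sub_one (d : ℕ) : d ∣ 2 ^ orderOf (2 : ZMod d) - 1 := by
  rw [← ZMod.natCast_eq_zero_iff, Nat.cast_sub Nat.one_le_two_pow]
  push_cast
  rw [pow_orderOf_eq_one, sub_self]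

theorem sum_inv_orderOf_two_le {η : ℝ} (hη : 0 < η) : ∃ C > (0 : ℝ), ∀ D : ℕ, Squarefree D →
    Odd D → ∀ Y : ℕ, 1 ≤ Y →
    ∑ d ∈ D.divisors with orderOf (2 : ZMod d) ≤ Y, 1 / (d : ℝ) ≤ C * (Y : ℝ) ^ (2 * η) := by
  obtain ⟨C, hC, H⟩ := prod_one_add_inv_le_of_card_le hη
  refine ⟨C, hC, fun D hD hodd Y hY => ?_⟩
  set Q := ∏ n ∈ Finset.Icc 1 Y, (2 ^ n - 1) with hQ
  have hQ0 : Q ≠ 0 := Finset.prod_ne_zero_iff.2 fun n hn => by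
    have : 2 ^ 1 ≤ 2 ^ n := Nat.pow_le_pow_right (by norm_num) (Finset.mem_Icc.1 hn).1
    omega
  have hQle : Q ≤ 2 ^ (Y ^ 2) := by
    calc Q ≤ ∏ n ∈ Finset.Icc 1 Y, 2 ^ Y := Finset.prod_le_prod' fun n hn =>
          (Nat.sub_le _ _).trans (Nat.pow_le_pow_right (by norm_num) (Finset.mem_Icc.1 hn).2)
      _ = _ := by simp [← pow_mul, sq]
  have hg : Squarefree (D.gcd Q) := hD.squarefree_of_dvd (Nat.gcd_dvd_left _ _)
  calc _ ≤ ∑ d ∈ (D.gcd Q).divisors, 1 / (d : ℝ) := by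
        refine Finset.sum_le_sum_of_subset_of_nonneg ?_ fun _ _ _ => by positivity
        intro d hd
        rw [Finset.mem_filter] at hd
        have hdD := Nat.dvd_of_mem_divisors hd.1
        refine Nat.mem_divisors.2 ⟨Nat.dvd_gcd hdD ?_, hg.ne_zero⟩
        refine (dvd_two_pow_orderOf_sub_one d).trans (Finset.dvd_prod_of_mem _ ?_)
        exact Finset.mem_Icc.2 ⟨orderOf_two_pos (Odd.of_dvd_nat hodd hdD), hd.2⟩
    _ = ∏ p ∈ (D.gcd Q).primeFactors, (1 + 1 / (p : ℝ)) := sum_divisors_inv_eq_prod hg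
    _ ≤ C * ((Y ^ 2 : ℕ) : ℝ) ^ η := by
        refine H _ (Nat.one_le_pow _ _ hY) _ (fun p hp => Nat.prime_of_mem_primeFactors hp) ?_
        refine (Finset.card_le_card (Nat.primeFactors_mono (Nat.gcd_dvd_right D Q) hQ0)).trans ?_
        exact card_primeFactors_le_of_le_two_pow hQ0 hQle
    _ = _ := by
        push_cast
        rw [← Real.rpow_natCast, ← Real.rpow_mul (by positivity)]
        norm_num

/-- Romanoff's series converges, in a form with an arbitrarily small power of the order. -/
theorem sum_inv_mul_orderOf_two_rpow_le {δ : ℝ} (hδ : 0 < δ) : ∃ C > (0 : ℝ), ∀ D : ℕ,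
    Squarefree D → Odd D →
    ∑ d ∈ D.divisors, 1 / (d : ℝ) * (orderOf (2 : ZMod d) : ℝ) ^ (-δ) ≤ C := by
  obtain ⟨C, hC, H⟩ := sum_inv_orderOf_two_le (η := δ / 4) (by positivity)
  set ρ : ℝ := 2 ^ (-δ / 2) with hρ
  have hρ0 : 0 < ρ := by positivity
  have hρ1 : ρ < 1 := Real.rpow_lt_one_of_one_lt_of_neg (by norm_num) (by linarith)
  refine ⟨C * 2 ^ (δ / 2) * (1 - ρ)⁻¹, by
    have : 0 < 1 - ρ := by linarith
    positivity, fun D hD hodd => ?_⟩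
  set e : ℕ → ℕ := fun d => orderOf (2 : ZMod d) with he
  set B := D.divisors.sup (fun d => Nat.log 2 (e d)) + 1 with hB
  have hmaps : ∀ d ∈ D.divisors, Nat.log 2 (e d) ∈ Finset.range B := fun d hd => by
    rw [Finset.mem_range, hB]
    exact Nat.lt_succ_of_le (Finset.le_sup (f := fun d => Nat.log 2 (e d)) hd)
  have hepos : ∀ d ∈ D.divisors, 0 < e d := fun d hd =>
    orderOf_two_pos (Odd.of_dvd_nat hodd (Nat.dvd_of_mem_divisors hd))
  rw [← Finset.sum_fiberwise_of_maps_to hmaps]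
  have hJ : ∀ J ∈ Finset.range B, ∑ d ∈ D.divisors with Nat.log 2 (e d) = J,
      1 / (d : ℝ) * (e d : ℝ) ^ (-δ) ≤ C * 2 ^ (δ / 2) * ρ ^ J := by
    intro J _
    calc _ ≤ ∑ d ∈ D.divisors with Nat.log 2 (e d) = J, 1 / (d : ℝ) * (2 ^ J : ℝ) ^ (-δ) := by
          refine Finset.sum_le_sum fun d hd => ?_
          rw [Finset.mem_filter] at hd
          gcongr ?_ * ?_
          refine Real.rpow_le_rpow_of_nonpos (by positivity) ?_ (by linarith)
          have := Nat.pow_log_le_self 2 (hepos d hd.1).ne'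
          rw [hd.2] at this
          exact_mod_cast this
      _ = (∑ d ∈ D.divisors with Nat.log 2 (e d) = J, 1 / (d : ℝ)) * (2 ^ J : ℝ) ^ (-δ) := by
          rw [Finset.sum_mul]
      _ ≤ (∑ d ∈ D.divisors with e d ≤ 2 ^ (J + 1), 1 / (d : ℝ)) * (2 ^ J : ℝ) ^ (-δ) := by
          refine mul_le_mul_of_nonneg_right ?_ (by positivity)
          refine Finset.sum_le_sum_of_subset_of_nonneg ?_ fun _ _ _ => by positivity
          intro d hd
          rw [Finset.mem_filter] at hd ⊢
          refine ⟨hd.1, ?_⟩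
          have := Nat.lt_pow_succ_log_self (b := 2) (by norm_num) (e d)
          rw [hd.2] at this
          exact this.le
      _ ≤ (C * ((2 ^ (J + 1) : ℕ) : ℝ) ^ (2 * (δ / 4))) * (2 ^ J : ℝ) ^ (-δ) := by
          gcongr
          exact H D hD hodd _ Nat.one_le_two_pow
      _ = C * 2 ^ (δ / 2) * ρ ^ J := by
          push_cast
          rw [mul_assoc, mul_assoc, hρ]
          congr 1
          simp only [← Real.rpow_natCast, ← Real.rpow_mul (by norm_num : (0 : ℝ) ≤ 2)]
          rw [← Real.rpow_add (by norm_num), ← Real.rpow_add (by norm_num)]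
          congr 1
          push_cast
          ring
  calc _ ≤ ∑ J ∈ Finset.range B, C * 2 ^ (δ / 2) * ρ ^ J := Finset.sum_le_sum hJ
    _ = C * 2 ^ (δ / 2) * ∑ J ∈ Finset.range B, ρ ^ J := by rw [Finset.mul_sum]
    _ ≤ _ := by
        gcongr
        rw [← tsum_geometric_of_lt_one hρ0.le hρ1]
        exact (summable_geometric_of_lt_one hρ0.le hρ1).sum_le_tsum _
          fun _ _ => by positivity

/-- The product of the odd primes up to `L`. -/
def oddPrimorial (L : ℕ) : ℕ := ∏ p ∈ (Finset.Icc 1 L).filter (fun p => p.Prime ∧ p ≠ 2), p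

theorem primeFactors_oddPrimorial (L : ℕ) :
    (oddPrimorial L).primeFactors = (Finset.Icc 1 L).filter (fun p => p.Prime ∧ p ≠ 2) :=
  Nat.primeFactors_prod fun _ hp => (Finset.mem_filter.1 hp).2.1

theorem squarefree_oddPrimorial (L : ℕ) : Squarefree (oddPrimorial L) := by
  refine Finset.squarefree_prod_of_pairwise_isCoprime ?_
    fun p hp => (Finset.mem_filter.1 hp).2.1.squarefree
  intro p hp q hq hpq
  have hp' := (Finset.mem_filter.1 hp).2.1
  have hq' := (Finset.mem_filter.1 hq).2.1
  exact Nat.coprime_iff_isRelPrime.1 ((Nat.coprime_primes hp' hq').2 hpq)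

theorem odd_oddPrimorial (L : ℕ) : Odd (oddPrimorial L) := by
  rw [← Nat.not_even_iff_odd, even_iff_two_dvd]
  intro h
  have : 2 ∈ (oddPrimorial L).primeFactors :=
    Nat.mem_primeFactors.2 ⟨Nat.prime_two, h, (squarefree_oddPrimorial L).ne_zero⟩
  rw [primeFactors_oddPrimorial] at this
  exact (Finset.mem_filter.1 this).2.2 rfl

theorem sum_divisors_oddPrimorial_inv_le {η : ℝ} (hη : 0 < η) : ∃ C > (0 : ℝ), ∀ L : ℕ, 1 ≤ L →
    ∑ d ∈ (oddPrimorial L).divisors, 1 / (d : ℝ) ≤ C * (L : ℝ) ^ η := by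
  obtain ⟨C, hC, H⟩ := prod_primes_one_add_inv_le hη
  refine ⟨C, hC, fun L hL => ?_⟩
  rw [sum_divisors_inv_eq_prod (squarefree_oddPrimorial L), primeFactors_oddPrimorial]
  refine (prod_one_add_inv_le_of_subset ?_).trans (H L hL)
  intro p hp
  rw [Finset.mem_filter] at hp ⊢
  exact ⟨hp.1, hp.2.1⟩

theorem prod_primeFactors_one_add_inv_le_sum (t : ℕ) {L h : ℕ} (hL : 1 ≤ L)
    (hh : 0 < h) (hle : h ≤ 2 ^ (L + t)) : ∏ p ∈ h.primeFactors, (1 + 1 / (p : ℝ)) ≤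
      (3 / 2 * Real.exp (1 + t)) * ∑ d ∈ (oddPrimorial L).divisors with d ∣ h, 1 / (d : ℝ) := by
  have hsq := squarefree_oddPrimorial L
  have hg : Squarefree ((oddPrimorial L).gcd h) := hsq.squarefree_of_dvd (Nat.gcd_dvd_left _ _)
  have h1 : ∑ d ∈ (oddPrimorial L).divisors with d ∣ h, 1 / (d : ℝ) =
      ∏ p ∈ ((oddPrimorial L).gcd h).primeFactors, (1 + 1 / (p : ℝ)) := by
    rw [← sum_divisors_inv_eq_prod hg]
    congr 1
    ext d
    simp only [Finset.mem_filter, Nat.mem_divisors, Nat.dvd_gcd_iff]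
    have := hsq.ne_zero
    have := hg.ne_zero
    tauto
  have h2 : h.primeFactors ⊆ ({2} ∪ ((oddPrimorial L).gcd h).primeFactors) ∪
      h.primeFactors.filter (L ≤ ·) := by
    intro p hp
    simp only [Finset.mem_union, Finset.mem_singleton, Finset.mem_filter]
    by_cases hpL : L ≤ p
    · exact Or.inr ⟨hp, hpL⟩
    · by_cases hp2 : p = 2
      · exact Or.inl (Or.inl hp2)
      · refine Or.inl (Or.inr ?_)
        have hpp := Nat.prime_of_mem_primeFactors hp
        have : p ∈ (oddPrimorial L).primeFactors := by
          rw [primeFactors_oddPrimorial, Finset.mem_filter, Finset.mem_Icc]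
          exact ⟨⟨hpp.one_lt.le, by omega⟩, hpp, hp2⟩
        exact Nat.mem_primeFactors.2 ⟨hpp, Nat.dvd_gcd (Nat.dvd_of_mem_primeFactors this)
          (Nat.dvd_of_mem_primeFactors hp), hg.ne_zero⟩
  have hunion : ∀ S T : Finset ℕ, ∏ p ∈ S ∪ T, (1 + 1 / (p : ℝ)) ≤
      (∏ p ∈ S, (1 + 1 / (p : ℝ))) * ∏ p ∈ T, (1 + 1 / (p : ℝ)) := by
    intro S T
    rw [← Finset.union_sdiff_self_eq_union, Finset.prod_union Finset.disjoint_sdiff]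
    have := prod_one_add_inv_le_of_subset (Finset.sdiff_subset : T \ S ⊆ T)
    have h0 : 0 ≤ ∏ p ∈ S, (1 + 1 / (p : ℝ)) := Finset.prod_nonneg fun _ _ => by positivity
    gcongr
  have h3 : ∏ p ∈ h.primeFactors with L ≤ p, (1 + 1 / (p : ℝ)) ≤ Real.exp (1 + t) := by
    refine (prod_one_add_inv_large_le (k := L + t) hL ?_ fun p hp => ?_).trans ?_
    · exact (Finset.card_filter_le _ _).trans (card_primeFactors_le_of_le_two_pow hh.ne' hle)
    · exact (Finset.mem_filter.1 hp).2
    · gcongr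
      have hL' : (1 : ℝ) ≤ L := by exact_mod_cast hL
      rw [div_le_iff₀ (by linarith)]
      push_cast
      have : (0 : ℝ) ≤ t := Nat.cast_nonneg t
      nlinarith
  rw [h1]
  refine (prod_one_add_inv_le_of_subset h2).trans ((hunion _ _).trans ?_)
  have h4 := hunion {2} ((oddPrimorial L).gcd h).primeFactors
  rw [Finset.prod_singleton] at h4
  set G := ∏ p ∈ ((oddPrimorial L).gcd h).primeFactors, (1 + 1 / (p : ℝ))
  have hG : 0 ≤ G := Finset.prod_nonneg fun _ _ => by positivity
  calc _ ≤ ((1 + 1 / ((2 : ℕ) : ℝ)) * G) * Real.exp (1 + t) := by gcongr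
    _ = _ := by push_cast; ring

/-- The number of ordered representations of an integer as a sum of `t` powers of two is bounded
in terms of `t`. -/
theorem exists_card_sum_two_pow_le (t : ℕ) : ∃ C : ℕ, ∀ (h : ℕ) (S : Finset (Fin t → ℕ)),
    (∀ b ∈ S, ∑ i, 2 ^ b i = h) → S.card ≤ C := by
  induction t with
  | zero =>
    exact ⟨1, fun h S _ => Finset.card_le_one.2 fun a _ b _ => Subsingleton.elim a b⟩
  | succ t ih =>
    obtain ⟨C, hC⟩ := ih
    refine ⟨(t + 1) * ((t + 2) * C), fun h S hS => ?_⟩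
    set J := Finset.Icc (Nat.log 2 h - (t + 1)) (Nat.log 2 h) with hJ
    have hcover : S ⊆ (Finset.univ : Finset (Fin (t + 1))).biUnion fun i =>
        J.biUnion fun c => S.filter fun b => b i = c := by
      intro b hb
      obtain ⟨i, -, hi⟩ := Finset.exists_max_image Finset.univ b ⟨(0 : Fin (t + 1)), by simp⟩
      have h1 : 2 ^ b i ≤ h := by
        rw [← hS b hb]
        exact Finset.single_le_sum (f := fun i => 2 ^ b i) (fun _ _ => Nat.zero_le _)
          (Finset.mem_univ i)
      have h2 : h < 2 ^ (b i + (t + 1) + 1) := by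
        rw [← hS b hb]
        calc ∑ j, 2 ^ b j ≤ ∑ _j : Fin (t + 1), 2 ^ b i :=
              Finset.sum_le_sum fun j hj => Nat.pow_le_pow_right (by norm_num) (hi j hj)
          _ = (t + 1) * 2 ^ b i := by simp
          _ < 2 ^ (t + 1) * 2 ^ b i := by
              gcongr
              exact Nat.lt_two_pow_self
          _ ≤ _ := by
              rw [← pow_add]
              exact Nat.pow_le_pow_right (by norm_num) (by omega)
      have h0 : h ≠ 0 := by have := Nat.one_le_two_pow (n := b i); omega
      have h3 := (Nat.le_log_iff_pow_le (by norm_num) h0).2 h1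
      have h4 := Nat.log_lt_of_lt_pow h0 h2
      simp only [Finset.mem_biUnion, Finset.mem_univ, true_and, Finset.mem_filter, hJ,
        Finset.mem_Icc]
      exact ⟨i, b i, ⟨by omega, h3⟩, hb, rfl⟩
    have hfib : ∀ (i : Fin (t + 1)) (c : ℕ), (S.filter fun b => b i = c).card ≤ C := by
      intro i c
      have hinj : Set.InjOn (fun b : Fin (t + 1) → ℕ => i.removeNth b)
          (S.filter fun b => b i = c) := by
        intro b hb b' hb' hbb
        rw [Finset.mem_coe, Finset.mem_filter] at hb hb'
        rw [← Fin.insertNth_self_removeNth i b, ← Fin.insertNth_self_removeNth i b', hb.2, hb'.2]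
        simp only at hbb
        rw [hbb]
      rw [← Finset.card_image_of_injOn hinj]
      refine hC (h - 2 ^ c) _ fun b' hb' => ?_
      obtain ⟨b, hb, rfl⟩ := Finset.mem_image.1 hb'
      rw [Finset.mem_filter] at hb
      have := hS b hb.1
      rw [Fin.sum_univ_succAbove _ i, hb.2] at this
      simp only [Fin.removeNth]
      omega
    calc S.card ≤ _ := Finset.card_le_card hcover
      _ ≤ ∑ i : Fin (t + 1), (J.biUnion fun c => S.filter fun b => b i = c).card :=
          Finset.card_biUnion_le
      _ ≤ ∑ _i : Fin (t + 1), (t + 2) * C := by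
          refine Finset.sum_le_sum fun i _ => ?_
          calc _ ≤ ∑ c ∈ J, (S.filter fun b => b i = c).card := Finset.card_biUnion_le
            _ ≤ ∑ _c ∈ J, C := Finset.sum_le_sum fun c _ => hfib i c
            _ = J.card * C := by simp
            _ ≤ _ := by
                gcongr
                rw [hJ, Nat.card_Icc]
                omega
      _ = _ := by simp

/-- The sum of the powers `2 ^ ⌊k i ^ ρ i⌋`. -/
noncomputable def twoPowSum {t : ℕ} (ρ : Fin t → ℝ) (k : Fin t → ℕ) : ℕ :=
  ∑ i, 2 ^ ⌊(k i : ℝ) ^ ρ i⌋₊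

theorem floor_rpow_strictMono {ρ : ℝ} (hρ : 1 ≤ ρ) : StrictMono fun k : ℕ => ⌊(k : ℝ) ^ ρ⌋₊ := by
  refine strictMono_nat_of_lt_succ fun k => ?_
  have h : (k : ℝ) ^ ρ + 1 ≤ ((k + 1 : ℕ) : ℝ) ^ ρ := by
    have := Real.add_rpow_le_rpow_add (Nat.cast_nonneg k) (zero_le_one (α := ℝ)) hρ
    rw [Real.one_rpow] at this
    push_cast
    exact this
  calc ⌊(k : ℝ) ^ ρ⌋₊ < ⌊(k : ℝ) ^ ρ⌋₊ + 1 := Nat.lt_succ_self _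
    _ = ⌊(k : ℝ) ^ ρ + 1⌋₊ := (Nat.floor_add_one (by positivity)).symm
    _ ≤ _ := Nat.floor_mono h

theorem exists_card_twoPowSum_eq_le {t : ℕ} (ρ : Fin t → ℝ) (hρ : ∀ i, 1 ≤ ρ i) :
    ∃ C : ℕ, ∀ (T : Finset (Fin t → ℕ)) (h : ℕ),
      (T.filter fun l => twoPowSum ρ l = h).card ≤ C := by
  obtain ⟨C, hC⟩ := exists_card_sum_two_pow_le t
  refine ⟨C, fun T h => ?_⟩
  have hinj : Function.Injective fun (l : Fin t → ℕ) i => ⌊(l i : ℝ) ^ ρ i⌋₊ := by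
    intro l l' hl
    funext i
    exact (floor_rpow_strictMono (hρ i)).injective (congrFun hl i)
  rw [← Finset.card_image_of_injective _ hinj]
  refine hC h _ fun b hb => ?_
  obtain ⟨l, hl, rfl⟩ := Finset.mem_image.1 hb
  exact (Finset.mem_filter.1 hl).2

theorem modEq_orderOf_of_two_pow_modEq {d a b : ℕ} (hd : Odd d) (h : 2 ^ a ≡ 2 ^ b [MOD d]) :
    a ≡ b [MOD orderOf (2 : ZMod d)] := by
  have h2 : IsUnit (2 : ZMod d) := by
    have := (ZMod.isUnit_iff_coprime 2 d).2 (Nat.coprime_two_left.2 hd)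
    exact_mod_cast this
  obtain ⟨u, hu⟩ := h2
  have h' := (ZMod.natCast_eq_natCast_iff _ _ _).2 h
  push_cast at h'
  rw [← hu] at h' ⊢
  rw [orderOf_units]
  exact pow_eq_pow_iff_modEq.1 (Units.ext (by push_cast; exact h'))

/-- Few points of a box have `twoPowSum` in a given residue class to an odd modulus. -/
theorem exists_card_twoPowSum_modEq_le {t : ℕ} (ρ : Fin t → ℝ) (hρ : ∀ i, 1 ≤ ρ i) (j : Fin t) :
    ∃ C > (0 : ℝ), ∃ δ > (0 : ℝ), ∀ (K : Fin t → ℕ) (d h : ℕ), (∀ i, 1 ≤ K i) → Odd d →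
      (((Fintype.piFinset fun i => Finset.Icc 1 (K i)).filter fun l =>
        twoPowSum ρ l ≡ h [MOD d]).card : ℝ) ≤
      C * (∏ i, (K i : ℝ)) * ((orderOf (2 : ZMod d) : ℝ) ^ (-δ) + (K j : ℝ) ^ (-δ)) := by
  obtain ⟨C, hC, δ, hδ, H⟩ := card_floor_rpow_modEq_le (ρ j) (hρ j)
  refine ⟨C, hC, δ, hδ, fun K d h hK hd => ?_⟩
  set e := orderOf (2 : ZMod d) with he
  have he0 : 0 < e := orderOf_two_pos hd
  set S := (Fintype.piFinset fun i => Finset.Icc 1 (K i)).filter fun l =>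
        twoPowSum ρ l ≡ h [MOD d] with hS
  set T' := Fintype.piFinset (Function.update (fun i => Finset.Icc 1 (K i)) j {1}) with hT'
  have hmaps : ∀ l ∈ S, Function.update l j 1 ∈ T' := by
    intro l hl
    rw [hS, Finset.mem_filter, Fintype.mem_piFinset] at hl
    rw [hT', Fintype.mem_piFinset]
    intro i
    by_cases hij : i = j
    · subst hij; simp
    · simpa [hij] using hl.1 i
  have hfib : ∀ u ∈ T', ((S.filter fun l => Function.update l j 1 = u).card : ℝ) ≤
      C * (K j * ((e : ℝ) ^ (-δ) + (K j : ℝ) ^ (-δ))) := by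
    intro u _
    rcases (S.filter fun l => Function.update l j 1 = u).eq_empty_or_nonempty with h0 | ⟨m, hm⟩
    · rw [h0, Finset.card_empty, Nat.cast_zero]
      positivity
    calc ((S.filter fun l => Function.update l j 1 = u).card : ℝ)
        ≤ (((Finset.Icc 1 (K j)).filter fun x : ℕ =>
            ⌊(x : ℝ) ^ ρ j⌋₊ ≡ ⌊(m j : ℝ) ^ ρ j⌋₊ [MOD e]).card : ℝ) := by
          norm_cast
          refine Finset.card_le_card_of_injOn (fun l => l j) ?_ ?_
          · intro l hl
            rw [Finset.mem_coe, Finset.mem_filter, hS, Finset.mem_filter,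
              Fintype.mem_piFinset] at hl
            rw [Finset.mem_filter, hS, Finset.mem_filter] at hm
            rw [Finset.mem_coe, Finset.mem_filter]
            refine ⟨hl.1.1 j, modEq_orderOf_of_two_pow_modEq hd ?_⟩
            have h1 := hl.1.2.trans hm.1.2.symm
            have hlm : ∀ i ≠ j, l i = m i := fun i hi => by
              have := congrFun (hl.2.trans hm.2.symm) i
              simpa [hi] using this
            unfold twoPowSum at h1
            rw [← Finset.add_sum_erase _ _ (Finset.mem_univ j),
              ← Finset.add_sum_erase (a := j) _ (fun i => 2 ^ ⌊(m i : ℝ) ^ ρ i⌋₊)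
                (Finset.mem_univ j),
              Finset.sum_congr rfl fun i hi => by rw [hlm i (Finset.ne_of_mem_erase hi)]] at h1
            exact Nat.ModEq.add_right_cancel' _ h1
          · intro l hl l' hl' hll
            rw [Finset.mem_coe, Finset.mem_filter] at hl hl'
            have := hl.2.trans hl'.2.symm
            funext i
            by_cases hij : i = j
            · subst hij; exact hll
            · simpa [hij] using congrFun this i
      _ ≤ C * (K j * ((min e (K j) : ℕ) : ℝ) ^ (-δ)) := H _ _ _ (hK j) he0
      _ ≤ _ := by
          gcongr
          rcases min_choice e (K j) with hmin | hmin <;> rw [hmin]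
          · linarith [Real.rpow_nonneg (Nat.cast_nonneg (K j)) (-δ)]
          · linarith [Real.rpow_nonneg (Nat.cast_nonneg e) (-δ)]
  have hcard : (T'.card : ℝ) * K j = ∏ i, (K i : ℝ) := by
    rw [hT', Fintype.card_piFinset, ← Finset.mul_prod_erase _ _ (Finset.mem_univ j),
      ← Finset.mul_prod_erase _ _ (Finset.mem_univ j),
      Finset.prod_congr rfl fun i hi => by
        rw [Function.update_of_ne (Finset.ne_of_mem_erase hi)]]
    simp
    ring
  calc (S.card : ℝ) = ∑ u ∈ T', ((S.filter fun l => Function.update l j 1 = u).card : ℝ) := by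
        exact_mod_cast Finset.card_eq_sum_card_fiberwise hmaps
    _ ≤ ∑ _u ∈ T', C * (K j * ((e : ℝ) ^ (-δ) + (K j : ℝ) ^ (-δ))) := Finset.sum_le_sum hfib
    _ = C * (T'.card * K j) * ((e : ℝ) ^ (-δ) + (K j : ℝ) ^ (-δ)) := by
        rw [Finset.sum_const, nsmul_eq_mul]
        ring
    _ = _ := by rw [hcard]

/-- The box of tuples `k` with `1 ≤ k i ≤ L ^ s i`. -/
noncomputable def rpowBox {t : ℕ} (s : Fin t → ℝ) (L : ℕ) : Finset (Fin t → ℕ) :=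
  Fintype.piFinset fun i => Finset.Icc 1 ⌊(L : ℝ) ^ s i⌋₊

section RpowBox

variable {t : ℕ} {s ρ : Fin t → ℝ} {L : ℕ}

theorem pos_of_mem_rpowBox {k : Fin t → ℕ} (hk : k ∈ rpowBox s L) (i : Fin t) : 0 < k i :=
  (Finset.mem_Icc.1 (Fintype.mem_piFinset.1 hk i)).1

theorem one_le_floor_of_mem_rpowBox (hρ : ∀ i, 1 ≤ ρ i) {k : Fin t → ℕ} (hk : k ∈ rpowBox s L)
    (i : Fin t) : 1 ≤ ⌊(k i : ℝ) ^ ρ i⌋₊ := by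
  refine Nat.le_floor ?_
  push_cast
  exact Real.one_le_rpow (by exact_mod_cast pos_of_mem_rpowBox hk i) (by linarith [hρ i])

theorem floor_le_of_mem_rpowBox (hρ : ∀ i, 1 ≤ ρ i) (hsρ : ∀ i, s i * ρ i ≤ 1) (hL : 1 ≤ L)
    {k : Fin t → ℕ} (hk : k ∈ rpowBox s L) (i : Fin t) : ⌊(k i : ℝ) ^ ρ i⌋₊ ≤ L := by
  have hL' : (1 : ℝ) ≤ L := by exact_mod_cast hL
  refine Nat.floor_le_of_le ?_
  have h1 := (Finset.mem_Icc.1 (Fintype.mem_piFinset.1 hk i)).2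
  have h2 : (k i : ℝ) ≤ (L : ℝ) ^ s i :=
    (Nat.cast_le.2 h1).trans (Nat.floor_le (by positivity))
  calc (k i : ℝ) ^ ρ i ≤ ((L : ℝ) ^ s i) ^ ρ i :=
        Real.rpow_le_rpow (by positivity) h2 (by linarith [hρ i])
    _ = (L : ℝ) ^ (s i * ρ i) := (Real.rpow_mul (by positivity) _ _).symm
    _ ≤ (L : ℝ) ^ (1 : ℝ) := Real.rpow_le_rpow_of_exponent_le hL' (hsρ i)
    _ = L := Real.rpow_one _

theorem twoPowSum_le_of_mem_rpowBox (hρ : ∀ i, 1 ≤ ρ i) (hsρ : ∀ i, s i * ρ i ≤ 1) (hL : 1 ≤ L)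
    {k : Fin t → ℕ} (hk : k ∈ rpowBox s L) : twoPowSum ρ k ≤ t * 2 ^ L := by
  calc twoPowSum ρ k ≤ ∑ _i : Fin t, 2 ^ L := Finset.sum_le_sum fun i _ =>
        Nat.pow_le_pow_right (by norm_num) (floor_le_of_mem_rpowBox hρ hsρ hL hk i)
    _ = _ := by simp

theorem even_twoPowSum_of_mem_rpowBox (hρ : ∀ i, 1 ≤ ρ i) {k : Fin t → ℕ}
    (hk : k ∈ rpowBox s L) : Even (twoPowSum ρ k) := by
  refine Finset.even_sum _ fun i _ => ?_
  have := one_le_floor_of_mem_rpowBox hρ hk i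
  exact (Nat.even_pow' (by omega)).2 even_two

theorem one_le_floor_rpow (hs : ∀ i, 0 < s i) (hL : 1 ≤ L) (i : Fin t) :
    1 ≤ ⌊(L : ℝ) ^ s i⌋₊ := by
  refine Nat.le_floor ?_
  push_cast
  exact Real.one_le_rpow (by exact_mod_cast hL) (hs i).le

theorem rpow_le_two_mul_floor (hs : ∀ i, 0 < s i) (hL : 1 ≤ L) (i : Fin t) :
    (L : ℝ) ^ s i ≤ 2 * ⌊(L : ℝ) ^ s i⌋₊ := by
  have h1 : (1 : ℝ) ≤ ⌊(L : ℝ) ^ s i⌋₊ := by exact_mod_cast one_le_floor_rpow hs hL i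
  linarith [Nat.lt_floor_add_one ((L : ℝ) ^ s i)]

theorem prod_rpow_eq (hs1 : ∑ i, s i = 1) (hL : 1 ≤ L) : ∏ i, (L : ℝ) ^ s i = L := by
  rw [← Real.rpow_sum_of_pos (by exact_mod_cast hL), hs1, Real.rpow_one]

theorem prod_floor_rpow_le (hs1 : ∑ i, s i = 1) (hL : 1 ≤ L) :
    ∏ i, (⌊(L : ℝ) ^ s i⌋₊ : ℝ) ≤ L := by
  calc _ ≤ ∏ i, (L : ℝ) ^ s i :=
        Finset.prod_le_prod (fun i _ => by positivity) fun i _ => Nat.floor_le (by positivity)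
    _ = _ := prod_rpow_eq hs1 hL

theorem card_rpowBox : ((rpowBox s L).card : ℝ) = ∏ i, (⌊(L : ℝ) ^ s i⌋₊ : ℝ) := by
  simp [rpowBox, Fintype.card_piFinset]

theorem card_rpowBox_le (hs1 : ∑ i, s i = 1) (hL : 1 ≤ L) : ((rpowBox s L).card : ℝ) ≤ L :=
  card_rpowBox.trans_le (prod_floor_rpow_le hs1 hL)

theorem le_two_pow_mul_card_rpowBox (hs : ∀ i, 0 < s i) (hs1 : ∑ i, s i = 1) (hL : 1 ≤ L) :
    (L : ℝ) ≤ 2 ^ t * (rpowBox s L).card := by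
  rw [card_rpowBox]
  calc (L : ℝ) = ∏ i, (L : ℝ) ^ s i := (prod_rpow_eq hs1 hL).symm
    _ ≤ ∏ i : Fin t, (2 * (⌊(L : ℝ) ^ s i⌋₊ : ℝ)) :=
        Finset.prod_le_prod (fun i _ => by positivity) fun i _ => rpow_le_two_mul_floor hs hL i
    _ = _ := by simp [Finset.prod_mul_distrib]

end RpowBox

/-- The singular factors of the differences of `twoPowSum` are bounded on average over a box. -/
theorem exists_sum_prod_primeFactors_twoPowSum_sub_le {t : ℕ} (j : Fin t) {s ρ : Fin t → ℝ}
    (hρ : ∀ i, 1 ≤ ρ i) (hs : ∀ i, 0 < s i) (hs1 : ∑ i, s i = 1) (hsρ : ∀ i, s i * ρ i ≤ 1) :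
    ∃ C > (0 : ℝ), ∀ L : ℕ, 1 ≤ L →
      ∑ k ∈ rpowBox s L, ∑ l ∈ rpowBox s L, (if twoPowSum ρ k < twoPowSum ρ l then
        ∏ p ∈ (twoPowSum ρ l - twoPowSum ρ k).primeFactors, (1 + 1 / (p : ℝ)) else 0) ≤
        C * (L : ℝ) ^ 2 := by
  obtain ⟨C, hC, δ, hδ, H⟩ := exists_card_twoPowSum_modEq_le ρ hρ j
  obtain ⟨C₁, hC₁, H₁⟩ := sum_inv_mul_orderOf_two_rpow_le hδ
  obtain ⟨C₂, hC₂, H₂⟩ := sum_divisors_oddPrimorial_inv_le (η := s j * δ) (mul_pos (hs j) hδ)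
  set A : ℝ := 3 / 2 * Real.exp (1 + t) with hA
  have hA0 : 0 < A := by positivity
  refine ⟨A * (C * (C₁ + C₂ * 2 ^ δ)), by positivity, fun L hL => ?_⟩
  set T := rpowBox s L with hT
  set D := (oddPrimorial L).divisors with hD
  set K : Fin t → ℕ := fun i => ⌊(L : ℝ) ^ s i⌋₊ with hK
  have hL0 : (0 : ℝ) < L := by exact_mod_cast hL
  have hterm : ∀ k ∈ T, ∀ l ∈ T, (if twoPowSum ρ k < twoPowSum ρ l then
      ∏ p ∈ (twoPowSum ρ l - twoPowSum ρ k).primeFactors, (1 + 1 / (p : ℝ)) else 0) ≤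
      A * ∑ d ∈ D, if twoPowSum ρ l ≡ twoPowSum ρ k [MOD d] then 1 / (d : ℝ) else 0 := by
    intro k _ l hl
    split_ifs with hkl
    · refine (prod_primeFactors_one_add_inv_le_sum t hL (Nat.sub_pos_of_lt hkl) ?_).trans ?_
      · calc twoPowSum ρ l - twoPowSum ρ k ≤ twoPowSum ρ l := Nat.sub_le _ _
          _ ≤ t * 2 ^ L := twoPowSum_le_of_mem_rpowBox hρ hsρ hL hl
          _ ≤ 2 ^ t * 2 ^ L := by gcongr; exact Nat.lt_two_pow_self.le
          _ = 2 ^ (L + t) := by rw [← pow_add, add_comm]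
      · rw [Finset.sum_filter]
        refine mul_le_mul_of_nonneg_left (Finset.sum_le_sum fun d _ => ?_) hA0.le
        by_cases hd : d ∣ twoPowSum ρ l - twoPowSum ρ k
        · rw [if_pos hd, if_pos ((Nat.modEq_iff_dvd' hkl.le).2 hd).symm]
        · rw [if_neg hd]
          split_ifs <;> positivity
    · refine mul_nonneg hA0.le (Finset.sum_nonneg fun d _ => ?_)
      split_ifs <;> positivity
  have hcount : ∀ d ∈ D, ∀ k ∈ T,
      (∑ l ∈ T, if twoPowSum ρ l ≡ twoPowSum ρ k [MOD d] then 1 / (d : ℝ) else 0) ≤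
      1 / (d : ℝ) * (C * L * ((orderOf (2 : ZMod d) : ℝ) ^ (-δ) + (K j : ℝ) ^ (-δ))) := by
    intro d hd k _
    rw [← Finset.sum_filter, Finset.sum_const, nsmul_eq_mul, mul_comm]
    refine mul_le_mul_of_nonneg_left ?_ (by positivity)
    refine (H K d (twoPowSum ρ k) (fun i => one_le_floor_rpow hs hL i)
      (Odd.of_dvd_nat (odd_oddPrimorial L) (Nat.dvd_of_mem_divisors hd))).trans ?_
    gcongr
    exact prod_floor_rpow_le hs1 hL
  have hKδ : (L : ℝ) ^ (s j * δ) * (K j : ℝ) ^ (-δ) ≤ 2 ^ δ := by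
    have hKpos : (0 : ℝ) < K j := by exact_mod_cast one_le_floor_rpow hs hL j
    rw [Real.rpow_mul hL0.le, Real.rpow_neg hKpos.le, ← div_eq_mul_inv, div_le_iff₀ (by positivity),
      ← Real.mul_rpow (by norm_num) hKpos.le]
    exact Real.rpow_le_rpow (by positivity) (rpow_le_two_mul_floor hs hL j) hδ.le
  calc _ ≤ ∑ k ∈ T, ∑ l ∈ T,
        A * ∑ d ∈ D, (if twoPowSum ρ l ≡ twoPowSum ρ k [MOD d] then 1 / (d : ℝ) else 0) :=
        Finset.sum_le_sum fun k hk => Finset.sum_le_sum fun l hl => hterm k hk l hl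
    _ = A * ∑ k ∈ T, ∑ d ∈ D, ∑ l ∈ T,
          (if twoPowSum ρ l ≡ twoPowSum ρ k [MOD d] then 1 / (d : ℝ) else 0) := by
        simp_rw [← Finset.mul_sum]
        congr 1
        exact Finset.sum_congr rfl fun k _ => Finset.sum_comm
    _ ≤ A * ∑ _k ∈ T, ∑ d ∈ D,
          1 / (d : ℝ) * (C * L * ((orderOf (2 : ZMod d) : ℝ) ^ (-δ) + (K j : ℝ) ^ (-δ))) :=
        mul_le_mul_of_nonneg_left (Finset.sum_le_sum fun k hk => Finset.sum_le_sum fun d hd =>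
          hcount d hd k hk) hA0.le
    _ = A * (T.card * (C * L * (∑ d ∈ D, 1 / (d : ℝ) * (orderOf (2 : ZMod d) : ℝ) ^ (-δ) +
          (∑ d ∈ D, 1 / (d : ℝ)) * (K j : ℝ) ^ (-δ)))) := by
        rw [Finset.sum_const, nsmul_eq_mul, Finset.sum_mul, ← Finset.sum_add_distrib,
          Finset.mul_sum D _ (C * L)]
        congr 2
        exact Finset.sum_congr rfl fun d _ => by ring
    _ ≤ A * (L * (C * L * (C₁ + C₂ * 2 ^ δ))) := by
        refine mul_le_mul_of_nonneg_left ?_ hA0.le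
        refine mul_le_mul (card_rpowBox_le hs1 hL) ?_ (by positivity) hL0.le
        refine mul_le_mul_of_nonneg_left (add_le_add ?_ ?_) (by positivity)
        · exact H₁ _ (squarefree_oddPrimorial L) (odd_oddPrimorial L)
        · calc _ ≤ C₂ * (L : ℝ) ^ (s j * δ) * (K j : ℝ) ^ (-δ) :=
                mul_le_mul_of_nonneg_right (H₂ L hL) (by positivity)
            _ = C₂ * ((L : ℝ) ^ (s j * δ) * (K j : ℝ) ^ (-δ)) := by ring
            _ ≤ _ := mul_le_mul_of_nonneg_left hKδ hC₂.le
    _ = _ := by ring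

/-- The Cauchy–Schwarz lower bound for the size of an image. -/
theorem sq_card_le_card_image_mul {α : Type*} (Q : Finset α) (φ : α → ℕ) :
    (Q.card : ℝ) ^ 2 ≤ (Q.image φ).card *
      ((Q ×ˢ Q).filter fun z => φ z.1 = φ z.2).card := by
  set r : ℕ → ℝ := fun n => ((Q.filter fun x => φ x = n).card : ℝ) with hr
  have h1 : (Q.card : ℝ) = ∑ n ∈ Q.image φ, r n := by
    simp only [hr]
    exact_mod_cast Finset.card_eq_sum_card_image φ Q
  have h2 : (((Q ×ˢ Q).filter fun z => φ z.1 = φ z.2).card : ℝ) = ∑ n ∈ Q.image φ, r n ^ 2 := by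
    have := Finset.card_eq_sum_card_fiberwise (s := (Q ×ˢ Q).filter fun z => φ z.1 = φ z.2)
      (f := fun z => φ z.1) (t := Q.image φ) (by
        intro z hz
        rw [Finset.mem_coe, Finset.mem_filter, Finset.mem_product] at hz
        exact Finset.mem_image_of_mem φ hz.1.1)
    rw [this]
    push_cast
    refine Finset.sum_congr rfl fun n _ => ?_
    rw [hr]
    simp only
    rw [sq, ← Nat.cast_mul, ← Finset.card_product]
    congr 2
    ext z
    simp only [Finset.mem_filter, Finset.mem_product]
    constructor
    · rintro ⟨⟨⟨ha, hb⟩, hab⟩, hn⟩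
      exact ⟨⟨ha, hn⟩, hb, hab ▸ hn⟩
    · rintro ⟨⟨ha, hn⟩, hb, hn'⟩
      exact ⟨⟨⟨ha, hb⟩, hn.trans hn'.symm⟩, hn⟩
  rw [h1, h2]
  exact sq_sum_le_card_mul_sum_sq

/-- Counting pairs of representations `p + h k = q + h l`. -/
theorem card_filter_add_eq_add_le {κ : Type*} (P : Finset ℕ) (T : Finset κ) (h : κ → ℕ)
    (F : ℕ → ℝ) (m : ℕ) (hm : ∀ c, (T.filter fun l => h l = c).card ≤ m)
    (hF : ∀ k ∈ T, ∀ l ∈ T, h k < h l →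
      ((P.filter fun q => q + (h l - h k) ∈ P).card : ℝ) ≤ F (h l - h k)) :
    ((((P ×ˢ T) ×ˢ (P ×ˢ T)).filter fun z => z.1.1 + h z.1.2 = z.2.1 + h z.2.2).card : ℝ) ≤
      T.card * (m * P.card) +
      2 * ∑ k ∈ T, ∑ l ∈ T, if h k < h l then F (h l - h k) else 0 := by
  classical
  set W : κ → κ → ℝ := fun k l =>
    (((P ×ˢ P).filter fun z => z.1 + h k = z.2 + h l).card : ℝ) with hW
  set G : κ → κ → ℝ := fun k l => if h k < h l then F (h l - h k) else 0 with hG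
  have hsum : ((((P ×ˢ T) ×ˢ (P ×ˢ T)).filter
      fun z => z.1.1 + h z.1.2 = z.2.1 + h z.2.2).card : ℝ) = ∑ k ∈ T, ∑ l ∈ T, W k l := by
    rw [← Finset.sum_product', Finset.card_eq_sum_card_fiberwise (f := fun z => (z.1.2, z.2.2))
      (t := T ×ˢ T)]
    · push_cast
      refine Finset.sum_congr rfl fun kl hkl => ?_
      rw [Finset.mem_product] at hkl
      rw [hW]
      simp only
      congr 1
      refine Finset.card_nbij' (fun z => (z.1.1, z.2.1))
        (fun z => ((z.1, kl.1), (z.2, kl.2))) ?_ ?_ ?_ ?_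
      · rintro ⟨⟨p, k⟩, ⟨q, l⟩⟩ hz
        simp only [Finset.coe_filter, Finset.mem_filter, Finset.mem_product,
          Set.mem_ofPred_eq] at hz ⊢
        obtain ⟨⟨⟨⟨hp, hk⟩, hq, hl⟩, he⟩, rfl⟩ := hz
        exact ⟨⟨hp, hq⟩, he⟩
      · rintro ⟨p, q⟩ hz
        simp only [Finset.coe_filter, Finset.mem_filter, Finset.mem_product,
          Set.mem_ofPred_eq] at hz ⊢
        exact ⟨⟨⟨⟨hz.1.1, hkl.1⟩, hz.1.2, hkl.2⟩, hz.2⟩, trivial⟩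
      · rintro ⟨⟨p, k⟩, ⟨q, l⟩⟩ hz
        simp only [Finset.coe_filter, Finset.mem_filter, Finset.mem_product,
          Set.mem_ofPred_eq] at hz ⊢
        obtain ⟨-, rfl⟩ := hz
        rfl
      · rintro ⟨p, q⟩ hz
        rfl
    · rintro ⟨⟨p, k⟩, ⟨q, l⟩⟩ hz
      simp only [Finset.coe_filter, Finset.mem_product, Set.mem_ofPred_eq] at hz
      simp only [Finset.coe_product, Set.mem_prod, Finset.mem_coe]
      exact ⟨hz.1.1.2, hz.1.2.2⟩
  have hlt : ∀ k ∈ T, ∀ l ∈ T, h k < h l → W k l ≤ G k l := by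
    intro k hk l hl hkl
    rw [hG]
    simp only [if_pos hkl]
    refine le_trans ?_ (hF k hk l hl hkl)
    simp only [hW]
    norm_cast
    refine Finset.card_le_card_of_injOn (fun z => z.2) ?_ ?_
    · rintro ⟨p, q⟩ hz
      simp only [Finset.coe_filter, Finset.mem_product, Set.mem_ofPred_eq] at hz ⊢
      refine ⟨hz.1.2, ?_⟩
      have : q + (h l - h k) = p := by omega
      rw [this]
      exact hz.1.1
    · rintro ⟨p, q⟩ hz ⟨p', q'⟩ hz' hqq
      simp only [Finset.coe_filter, Finset.mem_product, Set.mem_ofPred_eq] at hz hz' hqq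
      refine Prod.ext ?_ hqq
      simp only
      omega
  have hsymm : ∀ k l, W k l = W l k := by
    intro k l
    rw [hW]
    simp only
    congr 1
    refine Finset.card_nbij' Prod.swap Prod.swap ?_ ?_ (fun _ _ => rfl) (fun _ _ => rfl)
    all_goals
      rintro ⟨p, q⟩ hz
      simp only [Finset.coe_filter, Finset.mem_product, Set.mem_ofPred_eq, Prod.swap] at hz ⊢
      exact ⟨hz.1.symm, hz.2.symm⟩
  have hG0 : ∀ k ∈ T, ∀ l ∈ T, 0 ≤ G k l := by
    intro k hk l hl
    rw [hG]
    simp only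
    split_ifs with hkl
    · exact (Nat.cast_nonneg _).trans (hF k hk l hl hkl)
    · rfl
  have hWle : ∀ k ∈ T, ∀ l ∈ T,
      W k l ≤ (if h l = h k then (P.card : ℝ) else 0) + (G k l + G l k) := by
    intro k hk l hl
    rcases lt_trichotomy (h k) (h l) with hkl | hkl | hkl
    · rw [if_neg hkl.ne']
      linarith [hlt k hk l hl hkl, hG0 l hl k hk]
    · rw [if_pos hkl.symm]
      have : W k l ≤ P.card := by
        simp only [hW]
        norm_cast
        refine Finset.card_le_card_of_injOn (fun z => z.1) ?_ ?_
        · rintro ⟨p, q⟩ hz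
          simp only [Finset.coe_filter, Finset.mem_product, Set.mem_ofPred_eq] at hz ⊢
          exact hz.1.1
        · rintro ⟨p, q⟩ hz ⟨p', q'⟩ hz' hpp
          simp only [Finset.coe_filter, Finset.mem_product, Set.mem_ofPred_eq] at hz hz' hpp
          refine Prod.ext hpp ?_
          simp only
          omega
      linarith [hG0 l hl k hk, hG0 k hk l hl]
    · rw [if_neg hkl.ne, hsymm]
      linarith [hlt l hl k hk hkl, hG0 k hk l hl]
  rw [hsum]
  calc _ ≤ ∑ k ∈ T, ∑ l ∈ T, ((if h l = h k then (P.card : ℝ) else 0) + (G k l + G l k)) :=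
        Finset.sum_le_sum fun k hk => Finset.sum_le_sum fun l hl => hWle k hk l hl
    _ = (∑ k ∈ T, ∑ l ∈ T, if h l = h k then (P.card : ℝ) else 0) +
          (∑ k ∈ T, ∑ l ∈ T, G k l + ∑ k ∈ T, ∑ l ∈ T, G l k) := by
        simp only [Finset.sum_add_distrib]
    _ = (∑ k ∈ T, ∑ l ∈ T, if h l = h k then (P.card : ℝ) else 0) +
          2 * ∑ k ∈ T, ∑ l ∈ T, G k l := by
        rw [Finset.sum_comm (f := fun k l => G l k)]
        ring
    _ ≤ _ := by
        gcongr
        rw [← nsmul_eq_mul T.card]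
        refine Finset.sum_le_card_nsmul _ _ _ fun k _ => ?_
        rw [← Finset.sum_filter, Finset.sum_const, nsmul_eq_mul]
        gcongr
        exact hm _

theorem eventually_log_two_div {t : ℕ} (ht : 0 < t) : ∀ᶠ N : ℕ in atTop,
    1 ≤ Nat.log 2 (N / (2 * t)) ∧ (Nat.log 2 (N / (2 * t)) : ℝ) ≤ 2 * Real.log N ∧
    Real.log N ≤ 4 * Nat.log 2 (N / (2 * t)) ∧ t * 2 ^ Nat.log 2 (N / (2 * t)) ≤ N / 2 := by
  have hlog : Tendsto (fun N : ℕ => Real.log N) atTop atTop :=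
    Real.tendsto_log_atTop.comp tendsto_natCast_atTop_atTop
  filter_upwards [eventually_ge_atTop (4 * t),
    hlog.eventually_ge_atTop (2 * Real.log (2 * t))] with N hN hNlog
  set L := Nat.log 2 (N / (2 * t)) with hL
  have hdiv : 2 ≤ N / (2 * t) := (Nat.le_div_iff_mul_le (by omega)).2 (by omega)
  have hL1 : 1 ≤ L := (Nat.le_log_iff_pow_le (by norm_num) (by omega)).2 (by simpa using hdiv)
  have hpow : 2 ^ L ≤ N / (2 * t) := Nat.pow_log_le_self 2 (by omega)
  have hpow' : 2 ^ L * (2 * t) ≤ N := (Nat.le_div_iff_mul_le (by omega)).1 hpow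
  have hN0 : (0 : ℝ) < N := by
    have : 0 < N := by omega
    exact_mod_cast this
  have hl2 := Real.log_two_gt_d9
  have hl2' := Real.log_two_lt_d9
  refine ⟨hL1, ?_, ?_, ?_⟩
  · have h1 : (2 : ℝ) ^ L ≤ N := by
      have : 2 ^ L ≤ N := hpow.trans (Nat.div_le_self _ _)
      exact_mod_cast this
    have h2 := Real.log_le_log (by positivity) h1
    rw [Real.log_pow] at h2
    have : (0 : ℝ) ≤ L := Nat.cast_nonneg L
    nlinarith
  · have h1 : N / (2 * t) < 2 ^ (L + 1) := Nat.lt_pow_succ_log_self (by norm_num) _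
    have h2 : N < 2 ^ (L + 1) * (2 * t) := (Nat.div_lt_iff_lt_mul (by omega)).1 h1
    have h3 : (N : ℝ) ≤ 2 ^ (L + 1) * (2 * t) := by exact_mod_cast h2.le
    have h4 := Real.log_le_log hN0 h3
    have ht' : (0 : ℝ) < t := by exact_mod_cast ht
    rw [Real.log_mul (by positivity) (by positivity), Real.log_pow] at h4
    push_cast at h4
    have : (1 : ℝ) ≤ L := by exact_mod_cast hL1
    nlinarith
  · rw [Nat.le_div_iff_mul_le (by norm_num)]
    linarith

theorem eventually_le_card_odd_primes : ∃ c > (0 : ℝ), ∀ᶠ N : ℕ in atTop,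
    c * (N / Real.log N) ≤
      ((Finset.Icc 1 (N / 2)).filter fun p => p.Prime ∧ p ≠ 2).card := by
  obtain ⟨c, hc, H⟩ := eventually_mul_div_log_le_primeCounting
  refine ⟨c / 6, by positivity, ?_⟩
  have hhalf : Tendsto (fun N : ℕ => N / 2) atTop atTop :=
    Nat.tendsto_div_const_atTop (by norm_num)
  filter_upwards [hhalf.eventually H, eventually_ge_atTop 6] with N hN hN6
  have h3 : (3 : ℝ) * ((N / 2 : ℕ) : ℝ) ≥ N := by
    have : N ≤ 3 * (N / 2) := by omega
    exact_mod_cast this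
  have hx3 : 3 ≤ N / 2 := by omega
  have hxlog : 0 < Real.log ((N / 2 : ℕ) : ℝ) := by
    refine Real.log_pos ?_
    have : 1 < N / 2 := by omega
    exact_mod_cast this
  have hlog : Real.log ((N / 2 : ℕ) : ℝ) ≤ Real.log N := by
    refine Real.log_le_log ?_ (by exact_mod_cast Nat.div_le_self N 2)
    have : 0 < N / 2 := by omega
    exact_mod_cast this
  have hcard : (N / 2).primeCounting ≤
      2 * ((Finset.Icc 1 (N / 2)).filter fun p => p.Prime ∧ p ≠ 2).card := by
    have h1 : ((Finset.Icc 1 (N / 2)).filter fun p => p.Prime ∧ p ≠ 2) =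
        ((Finset.Icc 1 (N / 2)).filter Nat.Prime).erase 2 := by
      ext p
      simp only [Finset.mem_filter, Finset.mem_erase]
      tauto
    have h2 : 2 ∈ (Finset.Icc 1 (N / 2)).filter Nat.Prime := by
      rw [Finset.mem_filter, Finset.mem_Icc]
      exact ⟨⟨by norm_num, by omega⟩, Nat.prime_two⟩
    have h3 : 3 ∈ ((Finset.Icc 1 (N / 2)).filter Nat.Prime).erase 2 := by
      rw [Finset.mem_erase, Finset.mem_filter, Finset.mem_Icc]
      exact ⟨by norm_num, ⟨by norm_num, hx3⟩, Nat.prime_three⟩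
    have h4 := Finset.card_pos.2 ⟨3, h3⟩
    have h5 := Finset.card_erase_of_mem h2
    rw [← card_filter_prime_Icc, h1]
    omega
  have hcard' : ((N / 2).primeCounting : ℝ) ≤
      2 * ((Finset.Icc 1 (N / 2)).filter fun p => p.Prime ∧ p ≠ 2).card := by
    exact_mod_cast hcard
  have key : c / 3 * (N / Real.log N) ≤ c * (((N / 2 : ℕ) : ℝ) / Real.log ((N / 2 : ℕ) : ℝ)) := by
    calc c / 3 * (N / Real.log N) = c * ((N / 3) / Real.log N) := by ring
      _ ≤ c * (((N / 2 : ℕ) : ℝ) / Real.log ((N / 2 : ℕ) : ℝ)) := by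
          gcongr
          linarith
  linarith

/-- A positive proportion of the integers up to `N` are of the form `p + twoPowSum ρ k`. -/
theorem exists_card_prime_add_twoPowSum_ge {t : ℕ} (ht : 0 < t) {s ρ : Fin t → ℝ}
    (hρ : ∀ i, 1 ≤ ρ i) (hs : ∀ i, 0 < s i) (hs1 : ∑ i, s i = 1) (hsρ : ∀ i, s i * ρ i ≤ 1) :
    ∃ c > (0 : ℝ), ∀ᶠ N : ℕ in atTop, ∃ I : Finset ℕ, c * N ≤ I.card ∧ ∀ n ∈ I,
      n ≤ N ∧ Odd n ∧ ∃ (p : ℕ) (k : Fin t → ℕ), p.Prime ∧ (∀ i, 0 < k i) ∧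
        n = p + twoPowSum ρ k := by
  obtain ⟨c₁, hc₁, H₁⟩ := eventually_le_card_odd_primes
  obtain ⟨C₂, hC₂, H₂⟩ := primeCounting_le_mul_div_log
  obtain ⟨C₃, hC₃, H₃⟩ := card_twin_primes_le
  obtain ⟨m, hm⟩ := exists_card_twoPowSum_eq_le ρ hρ
  obtain ⟨C₄, hC₄, H₄⟩ := exists_sum_prod_primeFactors_twoPowSum_sub_le ⟨0, ht⟩ hρ hs hs1 hsρ
  set c₅ : ℝ := c₁ / (4 * 2 ^ t) with hc₅
  have hc₅0 : 0 < c₅ := by positivity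
  set E : ℝ := 2 * m * C₂ + 16 * C₃ * C₄ with hE
  have hE0 : 0 < E := by positivity
  refine ⟨c₅ ^ 2 / E, by positivity, ?_⟩
  filter_upwards [H₁, eventually_log_two_div ht, eventually_ge_atTop 9] with N hN₁ hN₂ hN9
  obtain ⟨hL1, hLle, hleL, hLN⟩ := hN₂
  set L := Nat.log 2 (N / (2 * t)) with hL
  set x := N / 2 with hx
  set P := (Finset.Icc 1 x).filter fun p => p.Prime ∧ p ≠ 2 with hP
  set T := rpowBox s L with hT
  have hN0 : (0 : ℝ) < N := by
    have : 0 < N := by omega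
    exact_mod_cast this
  have hlogN : 0 < Real.log N := Real.log_pos (by
    have : 1 < N := by omega
    exact_mod_cast this)
  have hx2 : 2 ≤ x := by omega
  have hxlog : Real.log N ≤ 2 * Real.log x := by
    have h1 : N ≤ x ^ 2 := by
      have h4 : 4 ≤ x := by omega
      have : N ≤ 2 * x + 1 := by omega
      nlinarith
    have h2 : (N : ℝ) ≤ (x : ℝ) ^ 2 := by exact_mod_cast h1
    have h3 := Real.log_le_log hN0 h2
    rwa [Real.log_pow] at h3
  have hxN : (x : ℝ) ≤ N / 2 := Nat.cast_div_le
  have hPle : (P.card : ℝ) ≤ C₂ * (N / Real.log N) := by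
    refine le_trans ?_ (H₂ N (by omega))
    rw [← card_filter_prime_Icc]
    norm_cast
    refine Finset.card_le_card fun p hp => ?_
    rw [hP, Finset.mem_filter, Finset.mem_Icc] at hp
    rw [Finset.mem_filter, Finset.mem_Icc]
    exact ⟨⟨hp.1.1, hp.1.2.trans (Nat.div_le_self _ _)⟩, hp.2.1⟩
  set Q := P ×ˢ T with hQ
  set φ : ℕ × (Fin t → ℕ) → ℕ := fun z => z.1 + twoPowSum ρ z.2 with hφ
  have hQge : c₅ * N ≤ Q.card := by
    have h1 := le_two_pow_mul_card_rpowBox hs hs1 hL1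
    rw [hQ, Finset.card_product]
    push_cast
    calc c₅ * N = (c₁ * (N / Real.log N)) * (Real.log N / (4 * 2 ^ t)) := by
          rw [hc₅]
          field_simp
      _ ≤ P.card * T.card := by
          refine mul_le_mul hN₁ ?_ (by positivity) (by positivity)
          rw [div_le_iff₀ (by positivity)]
          linarith
  have hpairs : (((Q ×ˢ Q).filter fun z => φ z.1 = φ z.2).card : ℝ) ≤ E * N := by
    have h1 := card_filter_add_eq_add_le P T (twoPowSum ρ)
      (fun h => C₃ * (x / Real.log x ^ 2 * ∏ p ∈ h.primeFactors, (1 + 1 / (p : ℝ)))) m (hm T) (by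
        intro k hk l hl hkl
        refine le_trans ?_ (H₃ _ x hx2 (Nat.sub_pos_of_lt hkl)
          ((Nat.even_sub hkl.le).2 (iff_of_true (even_twoPowSum_of_mem_rpowBox hρ hl)
            (even_twoPowSum_of_mem_rpowBox hρ hk))))
        norm_cast
        refine Finset.card_le_card fun q hq => ?_
        rw [Finset.mem_filter, hP, Finset.mem_filter, Finset.mem_filter] at hq
        rw [Finset.mem_filter]
        exact ⟨hq.1.1, hq.1.2.1, hq.2.2.1⟩)
    refine h1.trans ?_
    have h2 : (T.card : ℝ) * (m * P.card) ≤ 2 * m * C₂ * N := by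
      calc (T.card : ℝ) * (m * P.card)
          ≤ (2 * Real.log N) * (m * (C₂ * (N / Real.log N))) := by
            refine mul_le_mul ((card_rpowBox_le hs1 hL1).trans hLle) ?_ (by positivity)
              (by positivity)
            exact mul_le_mul_of_nonneg_left hPle (by positivity)
        _ = _ := by field_simp
    have h3 : ∑ k ∈ T, ∑ l ∈ T, (if twoPowSum ρ k < twoPowSum ρ l then
        C₃ * (x / Real.log x ^ 2 *
          ∏ p ∈ (twoPowSum ρ l - twoPowSum ρ k).primeFactors, (1 + 1 / (p : ℝ))) else 0) ≤
        8 * C₃ * C₄ * N := by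
      calc _ = C₃ * (x / Real.log x ^ 2) *
            ∑ k ∈ T, ∑ l ∈ T, (if twoPowSum ρ k < twoPowSum ρ l then
              ∏ p ∈ (twoPowSum ρ l - twoPowSum ρ k).primeFactors, (1 + 1 / (p : ℝ)) else 0) := by
            simp only [Finset.mul_sum, mul_ite, mul_zero, mul_assoc]
        _ ≤ C₃ * (x / Real.log x ^ 2) * (C₄ * (L : ℝ) ^ 2) :=
            mul_le_mul_of_nonneg_left (H₄ L hL1) (by positivity)
        _ ≤ C₃ * ((N / 2) / (Real.log N / 2) ^ 2) * (C₄ * (2 * Real.log N) ^ 2) := by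
            gcongr
            linarith
        _ = _ := by
            field_simp
            ring
    calc _ ≤ 2 * m * C₂ * N + 2 * (8 * C₃ * C₄ * N) := by gcongr
      _ = E * N := by rw [hE]; ring
  refine ⟨Q.image φ, ?_, ?_⟩
  · have h1 := sq_card_le_card_image_mul Q φ
    have h2 : (c₅ * N) ^ 2 ≤ (Q.image φ).card * (E * N) :=
      calc (c₅ * N) ^ 2 ≤ (Q.card : ℝ) ^ 2 := by gcongr
        _ ≤ _ := h1
        _ ≤ _ := by gcongr
    rw [div_mul_eq_mul_div, div_le_iff₀ hE0]
    refine le_of_mul_le_mul_right ?_ hN0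
    linarith
  · intro n hn
    obtain ⟨⟨p, k⟩, hz, rfl⟩ := Finset.mem_image.1 hn
    rw [hQ, Finset.mem_product, hP, Finset.mem_filter, Finset.mem_Icc] at hz
    obtain ⟨⟨⟨-, hpx⟩, hp, hp2⟩, hk⟩ := hz
    refine ⟨?_, (hp.odd_of_ne_two hp2).add_even (even_twoPowSum_of_mem_rpowBox hρ hk), p, k, hp,
      pos_of_mem_rpowBox hk, rfl⟩
    have : twoPowSum ρ k ≤ N / 2 := (twoPowSum_le_of_mem_rpowBox hρ hsρ hL1 hk).trans hLN
    simp only [hφ]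
    omega

theorem exists_floor_rpow_eq_floor_rpow_max {r : ℝ} (hr : 0 < r) {k : ℕ} (hk : 0 < k) :
    ∃ k' : ℕ, 0 < k' ∧ ⌊(k' : ℝ) ^ r⌋₊ = ⌊(k : ℝ) ^ max r 1⌋₊ := by
  rcases le_total 1 r with h | h
  · exact ⟨k, hk, by rw [max_eq_left h]⟩
  have hk0 : (0 : ℝ) < k := by exact_mod_cast hk
  refine ⟨⌈(k : ℝ) ^ r⁻¹⌉₊, Nat.ceil_pos.2 (by positivity), ?_⟩
  rw [max_eq_right h, Real.rpow_one, Nat.floor_natCast, Nat.floor_eq_iff (by positivity)]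
  constructor
  · calc (k : ℝ) = ((k : ℝ) ^ r⁻¹) ^ r := (Real.rpow_inv_rpow hk0.le hr.ne').symm
      _ ≤ _ := Real.rpow_le_rpow (by positivity) (Nat.le_ceil _) hr.le
  · calc (⌈(k : ℝ) ^ r⁻¹⌉₊ : ℝ) ^ r < ((k : ℝ) ^ r⁻¹ + 1) ^ r :=
          Real.rpow_lt_rpow (by positivity) (Nat.ceil_lt_add_one (by positivity)) hr
      _ ≤ ((k : ℝ) ^ r⁻¹) ^ r + 1 ^ r :=
          Real.rpow_add_le_add_rpow (by positivity) zero_le_one hr.le h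
      _ = k + 1 := by rw [Real.rpow_inv_rpow hk0.le hr.ne', Real.one_rpow]

/-- The set of odd numbers up to `N` of the form `p + ∑ i, 2 ^ ⌊k i ^ r i⌋`. -/
def romanoffSet {t : ℕ} (r : Fin t → ℝ) (N : ℕ) : Set ℕ :=
  {n : ℕ | n ≤ N ∧ Odd n ∧ ∃ (p : ℕ) (k : Fin t → ℕ), p.Prime ∧ (∀ i, 0 < k i) ∧
    n = p + ∑ i, 2 ^ ⌊(k i : ℝ) ^ (r i)⌋₊}

theorem romanoffSet_subset {t : ℕ} (r : Fin t → ℝ) (N : ℕ) : romanoffSet r N ⊆ Set.Iic N :=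
  fun _ hn => hn.1

theorem finite_romanoffSet {t : ℕ} (r : Fin t → ℝ) (N : ℕ) : (romanoffSet r N).Finite :=
  (Set.finite_Iic N).subset (romanoffSet_subset r N)

theorem exists_eventually_le_ncard_romanoffSet {t : ℕ} (ht : 0 < t) {r : Fin t → ℝ}
    (hr : ∀ i, 0 < r i) (hsum : 1 ≤ ∑ i, (r i)⁻¹) :
    ∃ c > (0 : ℝ), ∀ᶠ N : ℕ in atTop, c * N ≤ (romanoffSet r N).ncard := by
  set ρ : Fin t → ℝ := fun i => max (r i) 1 with hρ
  have hρ1 : ∀ i, 1 ≤ ρ i := fun i => le_max_right _ _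
  have hρ0 : ∀ i, 0 < ρ i := fun i => zero_lt_one.trans_le (hρ1 i)
  set σ := ∑ i, (ρ i)⁻¹ with hσ
  have hσ1 : 1 ≤ σ := by
    by_cases h : ∀ i, 1 ≤ r i
    · simpa only [hσ, hρ, max_eq_left (h _)] using hsum
    · push Not at h
      obtain ⟨i, hi⟩ := h
      have h1 : (ρ i)⁻¹ = 1 := by
        rw [hρ]
        simp only [max_eq_right hi.le, inv_one]
      rw [← h1]
      exact Finset.single_le_sum (f := fun i => (ρ i)⁻¹) (fun i _ => (inv_pos.2 (hρ0 i)).le)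
        (Finset.mem_univ i)
  have hσ0 : 0 < σ := zero_lt_one.trans_le hσ1
  obtain ⟨c, hc, H⟩ := exists_card_prime_add_twoPowSum_ge ht (s := fun i => (ρ i)⁻¹ / σ) hρ1
    (fun i => div_pos (inv_pos.2 (hρ0 i)) hσ0) (by rw [← Finset.sum_div, div_self hσ0.ne'])
    (fun i => by
      rw [div_mul_eq_mul_div, inv_mul_cancel₀ (hρ0 i).ne']
      exact (div_le_one hσ0).2 hσ1)
  refine ⟨c, hc, H.mono fun N hN => ?_⟩
  obtain ⟨I, hI, hIs⟩ := hN
  refine hI.trans ?_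
  rw [← Set.ncard_coe_finset, Nat.cast_le]
  refine Set.ncard_le_ncard (fun n hn => ?_) (finite_romanoffSet r N)
  obtain ⟨hnN, hodd, p, k, hp, hk, hn'⟩ := hIs n hn
  choose k' hk' hkk' using fun i => exists_floor_rpow_eq_floor_rpow_max (hr i) (hk i)
  refine ⟨hnN, hodd, p, k', hp, hk', ?_⟩
  rw [hn', twoPowSum]
  congr 1
  exact Finset.sum_congr rfl fun i _ => by rw [hkk' i]

theorem ncard_romanoffSet_le {t : ℕ} {r : Fin t → ℝ} (hr : ∀ i, 0 < r i) {N : ℕ} (hN : 0 < N) :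
    ((romanoffSet r N).ncard : ℝ) ≤
      N.primeCounting * ((Nat.log 2 N : ℝ) + 1) ^ ∑ i, (r i)⁻¹ := by
  set M := Nat.log 2 N with hM
  set K : Fin t → ℕ := fun i => ⌊((M : ℝ) + 1) ^ (r i)⁻¹⌋₊ with hK
  set Q := (Finset.Icc 1 N).filter Nat.Prime ×ˢ Fintype.piFinset fun i => Finset.Icc 1 (K i)
    with hQ
  have hsub : romanoffSet r N ⊆
      (Q.image fun z => z.1 + ∑ i, 2 ^ ⌊(z.2 i : ℝ) ^ (r i)⌋₊ : Finset ℕ) := by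
    rintro n ⟨hnN, -, p, k, hp, hk, rfl⟩
    rw [Finset.mem_coe, Finset.mem_image]
    refine ⟨(p, k), ?_, rfl⟩
    rw [hQ, Finset.mem_product, Finset.mem_filter, Finset.mem_Icc, Fintype.mem_piFinset]
    refine ⟨⟨⟨hp.one_le, by simp only; omega⟩, hp⟩, fun i => Finset.mem_Icc.2 ⟨hk i, ?_⟩⟩
    have h1 : 2 ^ ⌊(k i : ℝ) ^ r i⌋₊ ≤ N := by
      refine le_trans ?_ ((Nat.le_add_left _ _).trans hnN)
      exact Finset.single_le_sum (f := fun i => 2 ^ ⌊(k i : ℝ) ^ r i⌋₊)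
        (fun _ _ => Nat.zero_le _) (Finset.mem_univ i)
    have h2 : ⌊(k i : ℝ) ^ r i⌋₊ ≤ M := (Nat.le_log_iff_pow_le (by norm_num) hN.ne').2 h1
    have h3 : (k i : ℝ) ^ r i ≤ M + 1 := by
      have : (⌊(k i : ℝ) ^ r i⌋₊ : ℝ) ≤ M := by exact_mod_cast h2
      linarith [Nat.lt_floor_add_one ((k i : ℝ) ^ r i)]
    refine Nat.le_floor ?_
    calc (k i : ℝ) = ((k i : ℝ) ^ r i) ^ (r i)⁻¹ :=
          (Real.rpow_rpow_inv (by positivity) (hr i).ne').symm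
      _ ≤ _ := Real.rpow_le_rpow (by positivity) h3 (inv_pos.2 (hr i)).le
  calc ((romanoffSet r N).ncard : ℝ) ≤ Q.card := by
        norm_cast
        refine (Set.ncard_le_ncard hsub (Finset.finite_toSet _)).trans ?_
        rw [Set.ncard_coe_finset]
        exact Finset.card_image_le
    _ = N.primeCounting * ∏ i, (K i : ℝ) := by
        rw [hQ, Finset.card_product, card_filter_prime_Icc, Fintype.card_piFinset]
        push_cast
        simp
    _ ≤ N.primeCounting * ∏ i, ((M : ℝ) + 1) ^ (r i)⁻¹ := by
        refine mul_le_mul_of_nonneg_left ?_ (by positivity)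
        exact Finset.prod_le_prod (fun i _ => by positivity) fun i _ => Nat.floor_le (by positivity)
    _ = _ := by rw [← Real.rpow_sum_of_pos (by positivity)]

theorem tendsto_ncard_romanoffSet_div {t : ℕ} {r : Fin t → ℝ} (hr : ∀ i, 0 < r i)
    (hsum : ∑ i, (r i)⁻¹ < 1) :
    Tendsto (fun N : ℕ => ((romanoffSet r N).ncard : ℝ) / N) atTop (nhds 0) := by
  obtain ⟨C, hC, H⟩ := primeCounting_le_mul_div_log
  set σ := ∑ i, (r i)⁻¹ with hσ
  have hσ0 : 0 ≤ σ := Finset.sum_nonneg fun i _ => (inv_pos.2 (hr i)).le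
  have hlog : Tendsto (fun N : ℕ => Real.log N) atTop atTop :=
    Real.tendsto_log_atTop.comp tendsto_natCast_atTop_atTop
  have hlim : Tendsto (fun N : ℕ => C * 3 ^ σ * (Real.log N) ^ (-(1 - σ))) atTop (nhds 0) := by
    have := ((tendsto_rpow_neg_atTop (y := 1 - σ) (by linarith)).comp hlog).const_mul (C * 3 ^ σ)
    rwa [mul_zero] at this
  refine squeeze_zero' (Eventually.of_forall fun N => by positivity) ?_ hlim
  filter_upwards [eventually_ge_atTop 2, hlog.eventually_ge_atTop 1] with N hN hN1
  have hN0 : (0 : ℝ) < N := by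
    have : 0 < N := by omega
    exact_mod_cast this
  have hM : (Nat.log 2 N : ℝ) + 1 ≤ 3 * Real.log N := by
    have h1 : ((2 : ℝ)) ^ Nat.log 2 N ≤ N := by
      exact_mod_cast Nat.pow_log_le_self 2 (by omega : N ≠ 0)
    have h2 := Real.log_le_log (by positivity) h1
    rw [Real.log_pow] at h2
    have := Real.log_two_gt_d9
    have : (0 : ℝ) ≤ Nat.log 2 N := Nat.cast_nonneg _
    nlinarith
  rw [div_le_iff₀ hN0]
  calc ((romanoffSet r N).ncard : ℝ) ≤ N.primeCounting * ((Nat.log 2 N : ℝ) + 1) ^ σ :=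
        ncard_romanoffSet_le hr (by omega)
    _ ≤ C * (N / Real.log N) * (3 * Real.log N) ^ σ := by
        gcongr
        exact H N hN
    _ = _ := by
        rw [Real.mul_rpow (by norm_num) (by positivity), neg_sub,
          Real.rpow_sub_one (by positivity)]
        ring

theorem zero_lt_liminf_romanoffSet_iff (t : ℕ) (ht : 0 < t) (r : Fin t → ℝ)
    (hr : ∀ i, 0 < r i) :
    0 < atTop.liminf (fun N : ℕ => ((romanoffSet r N).ncard : ℝ) / (N : ℝ)) ↔
      1 ≤ ∑ i, (r i)⁻¹ := by
  constructor
  · intro h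
    by_contra! hlt
    rw [(tendsto_ncard_romanoffSet_div hr hlt).liminf_eq] at h
    exact lt_irrefl _ h
  · intro h
    obtain ⟨c, hc, H⟩ := exists_eventually_le_ncard_romanoffSet ht hr h
    have hbdd : IsBoundedUnder (· ≤ ·) atTop
        (fun N : ℕ => ((romanoffSet r N).ncard : ℝ) / (N : ℝ)) := by
      refine isBoundedUnder_of_eventually_le (a := 2) ?_
      filter_upwards [eventually_ge_atTop 1] with N hN
      have hN' : (1 : ℝ) ≤ N := by exact_mod_cast hN
      rw [div_le_iff₀ (by linarith)]
      have h1 : (romanoffSet r N).ncard ≤ N + 1 := by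
        refine (Set.ncard_le_ncard (romanoffSet_subset r N) (Set.finite_Iic N)).trans ?_
        rw [← Finset.coe_Iic, Set.ncard_coe_finset, Nat.card_Iic]
      have h2 : ((romanoffSet r N).ncard : ℝ) ≤ N + 1 := by exact_mod_cast h1
      linarith
    refine hc.trans_le (le_liminf_of_le hbdd.isCoboundedUnder_ge ?_)
    filter_upwards [H, eventually_gt_atTop 0] with N hN hN0
    rw [le_div_iff₀ (by exact_mod_cast hN0)]
    exact hN

/-- For positive reals `r_1,...,r_t`, the set `R₂(r_1,...,r_t)` of odd
positive integers representable as `p + 2^⌊k_1^{r_1}⌋ + ... + 2^⌊k_t^{r_t}⌋` (with `p` prime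
and the `k_i` positive integers) has positive lower asymptotic density iff
`1/r_1 + ... + 1/r_t ≥ 1`. -/
theorem romanoff_generalization (t : ℕ) (ht : 0 < t) (r : Fin t → ℝ)
    (hr : ∀ i, 0 < r i) :
    (0 < atTop.liminf (fun N : ℕ =>
      (({n : ℕ | n ≤ N ∧ Odd n ∧ ∃ (p : ℕ) (k : Fin t → ℕ), p.Prime ∧
        (∀ i, 0 < k i) ∧
        n = p + ∑ i, 2 ^ ⌊(k i : ℝ) ^ (r i)⌋₊} : Set ℕ).ncard : ℝ) / (N : ℝ)))
    ↔ 1 ≤ ∑ i, (r i)⁻¹ := by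
  exact zero_lt_liminf_romanoffSet_iff t ht r hr
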